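/- arXiv:math/0301275 — 4 statements merged into one kernel-verified Lean document; each statement's English description precedes it below -/
import Mathlib

section
/- There are absolute positive constants η and α such that for every positive integer k and every l ≤ α k, the probability (with respect to P) that there exists some a ∈ F_l^k with |k^{-1} Σ_{j=1}^k |Σ_{i=1}^k a_i ε_{i,j}| − E_1(a)| > E_1(a)/4 is at most e^{−η k}. -/
open Finset

/-- The sign `±1` associated to a boolean. -/
noncomputable def sgn (b : Bool) : ℝ := if b then 1 else -1

open scoped Classical in
/-- The probability, under the uniform measure on sign arrays
`{ε_{i,j}}_{i,j=1}^k ∈ {−1,1}^{k²}`, of an event `pred`. -/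
noncomputable def signProb (k : ℕ) (pred : (Fin k → Fin k → Bool) → Prop) : ℝ :=
  ((Finset.univ : Finset (Fin k → Fin k → Bool)).filter pred).card / 2 ^ (k * k)

/-- `E_1(a)`: the average over all sign arrays of `k⁻¹ ∑_j |∑_i a_i ε_{i,j}|`. -/
noncomputable def E1 (k : ℕ) (a : Fin k → ℝ) : ℝ :=
  (∑ ε : Fin k → Fin k → Bool, (k : ℝ)⁻¹ * ∑ j, |∑ i, a i * sgn (ε i j)|) / 2 ^ (k * k)

open scoped Classical in
/-- `F_l^k`: vectors in the Euclidean unit ball of `ℝ^k` with at most `l` nonzero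
coordinates. -/
noncomputable def Flk (k l : ℕ) : Set (Fin k → ℝ) :=
  {a | (∑ i, a i ^ 2) ≤ 1 ∧ (Finset.univ.filter fun i => a i ≠ 0).card ≤ l}


lemma aux_trunc (y : ℝ) : ∃ z : ℤ, |(z:ℝ)| ≤ |y| ∧ |y - z| ≤ 1 := by
  rcases le_total 0 y with h | h
  · refine ⟨⌊y⌋, ?_, ?_⟩
    · have : (0:ℝ) ≤ (⌊y⌋:ℤ) := by exact_mod_cast Int.floor_nonneg.2 h
      rw [abs_of_nonneg this, abs_of_nonneg h]; exact Int.floor_le y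
    · rw [abs_le]; constructor <;> linarith [Int.floor_le y, Int.lt_floor_add_one y]
  · refine ⟨⌈y⌉, ?_, ?_⟩
    · have : ((⌈y⌉:ℤ):ℝ) ≤ 0 := by exact_mod_cast Int.ceil_le.2 (by simpa using h)
      rw [abs_of_nonpos this, abs_of_nonpos h]; linarith [Int.le_ceil y]
    · rw [abs_le]; constructor <;> linarith [Int.le_ceil y, Int.ceil_lt_add_one y]

noncomputable def lat (k l : ℕ) (z : Fin k → ℤ) : Fin k → ℝ :=
  fun i => (z i : ℝ) / (48 * Real.sqrt l)

open scoped Classical in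
noncomputable def ZZ (k l : ℕ) : Finset (Fin k → ℤ) :=
  (Fintype.piFinset fun _ => Finset.Icc (-(48 * l : ℤ)) (48 * l)).filter fun z =>
    (Finset.univ.filter fun i => z i ≠ 0).card ≤ l ∧ ∑ i, (z i).natAbs ≤ 48 * l ∧
    ∑ i, (lat k l z i) ^ 2 ≤ 1

lemma aux_net (k l : ℕ) (hl : 1 ≤ l) (a : Fin k → ℝ) (ha : a ∈ Flk k l) :
    ∃ z ∈ ZZ k l, (48 : ℝ) • (a - lat k l z) ∈ Flk k l := by
  classical
  obtain ⟨h1, h2⟩ := ha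
  have hl0 : (0:ℝ) < l := by exact_mod_cast hl
  set q : ℝ := Real.sqrt l with hq
  have hq0 : 0 < q := Real.sqrt_pos.2 hl0
  have hqq : q ^ 2 = l := Real.sq_sqrt hl0.le
  choose z hz1 hz2 using fun i => aux_trunc (a i * (48 * q))
  have hz0 : ∀ i, a i = 0 → z i = 0 := by
    intro i hi
    have := hz1 i
    rw [hi] at this
    simpa using this
  have hlat : ∀ i, |lat k l z i| ≤ |a i| := by
    intro i
    have := hz1 i
    rw [abs_mul, abs_of_pos (show (0:ℝ) < 48 * q by positivity)] at this
    rw [lat, abs_div, abs_of_pos (show (0:ℝ) < 48 * Real.sqrt l by positivity), div_le_iff₀ (by positivity)]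
    exact this
  have hdiff : ∀ i, |48 * (a i - lat k l z i)| ≤ 1 / q := by
    intro i
    have := hz2 i
    have e : 48 * (a i - lat k l z i) = (a i * (48 * q) - z i) / q := by
      rw [lat, ← hq]; field_simp
    rw [e, abs_div, abs_of_pos hq0]
    gcongr
  have hsum : ∑ i, |a i| ≤ q := by
    have h3 : ∑ i, |a i| = ∑ i ∈ Finset.univ.filter (fun i => a i ≠ 0), |a i| := by
      rw [Finset.sum_filter]; refine Finset.sum_congr rfl fun i _ => ?_
      by_cases h : a i = 0 <;> simp [h]
    have h4 : (∑ i, |a i|) ^ 2 ≤ q ^ 2 := by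
      rw [h3, hqq]
      refine (sq_sum_le_card_mul_sum_sq).trans ?_
      have h5 : ∑ i ∈ Finset.univ.filter (fun i => a i ≠ 0), |a i| ^ 2 ≤ 1 := by
        refine le_trans ?_ h1
        simp only [sq_abs]
        exact Finset.sum_le_sum_of_subset_of_nonneg (Finset.filter_subset _ _) (fun i _ _ => sq_nonneg _)
      have h6 : ((Finset.univ.filter (fun i => a i ≠ 0)).card : ℝ) ≤ l := by
        exact_mod_cast h2
      have : 0 ≤ ∑ i ∈ Finset.univ.filter (fun i => a i ≠ 0), |a i| ^ 2 := by positivity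
      nlinarith
    exact abs_le_of_sq_le_sq' h4 hq0.le |>.2
  have hzsum : ∑ i, (z i).natAbs ≤ 48 * l := by
    have : ((∑ i, (z i).natAbs : ℕ) : ℝ) ≤ 48 * l := by
      push_cast
      calc ∑ i, (((z i).natAbs : ℕ) : ℝ) ≤ ∑ i, |a i| * (48 * q) := by
            refine Finset.sum_le_sum fun i _ => ?_
            have := hz1 i
            rw [abs_mul, abs_of_pos (show (0:ℝ) < 48 * q by positivity)] at this
            rw [Nat.cast_natAbs]; push_cast; exact this
        _ = (∑ i, |a i|) * (48 * q) := by rw [Finset.sum_mul]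
        _ ≤ q * (48 * q) := by gcongr
        _ = 48 * l := by rw [← hqq]; ring
    exact_mod_cast this
  refine ⟨z, ?_, ?_, ?_⟩
  · rw [ZZ, Finset.mem_filter]
    refine ⟨?_, ?_, hzsum, ?_⟩
    · rw [Fintype.mem_piFinset]; intro i
      have := Finset.single_le_sum (f := fun i => (z i).natAbs) (fun i _ => Nat.zero_le _) (Finset.mem_univ i)
      have h' : (z i).natAbs ≤ ∑ i, (z i).natAbs := this
      rw [Finset.mem_Icc]; omega
    · refine (Finset.card_le_card ?_).trans h2
      intro i; simp only [Finset.mem_filter, Finset.mem_univ, true_and]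
      exact fun h h' => h (hz0 i h')
    · refine le_trans (Finset.sum_le_sum fun i _ => ?_) h1
      exact sq_le_sq.2 (hlat i)
  · have h3 : ∀ i, ((48:ℝ) • (a - lat k l z)) i = 48 * (a i - lat k l z i) := fun i => by simp
    simp only [h3]
    calc ∑ i, (48 * (a i - lat k l z i)) ^ 2 ≤ ∑ i, if a i ≠ 0 then 1 / (l:ℝ) else 0 := by
          refine Finset.sum_le_sum fun i _ => ?_
          split_ifs with h
          · rw [← hqq, ← one_div_pow, ← sq_abs]
            exact pow_le_pow_left₀ (abs_nonneg _) (hdiff i) 2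
          · push Not at h
            simp [lat, hz0 i h, h]
      _ = ((Finset.univ.filter (fun i => a i ≠ 0)).card : ℝ) * (1 / l) := by
          rw [← Finset.sum_filter]; simp
      _ ≤ l * (1 / l) := by gcongr
      _ = 1 := by field_simp
  · refine (Finset.card_le_card ?_).trans h2
    intro i; simp only [Finset.mem_filter, Finset.mem_univ, true_and]
    intro h h'
    apply h; simp [lat, h', hz0 i h']

lemma aux_det (k l : ℕ) (hl : 1 ≤ l) (N m : Seminorm ℝ (Fin k → ℝ)) (B : ℝ)
    (hB : ∀ a ∈ Flk k l, N a ≤ B)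
    (hm1 : ∀ a, ∑ i, a i ^ 2 ≤ 1 → m a ≤ 1)
    (hm2 : ∀ a, ∑ i, a i ^ 2 = 1 → 1 / 2 ≤ m a)
    (hZ : ∀ z ∈ ZZ k l, |N (lat k l z) - m (lat k l z)| ≤ 1 / 16)
    (a : Fin k → ℝ) (ha : a ∈ Flk k l) : |N a - m a| ≤ m a / 4 := by
  classical
  have key : ∀ a : Fin k → ℝ, a = (a - (1/48:ℝ) • ((48:ℝ) • a)) + (1/48:ℝ) • ((48:ℝ) • a) := by
    intro a; simp
  have hsc : ∀ (s : Seminorm ℝ (Fin k → ℝ)) (b : Fin k → ℝ), s ((48:ℝ) • b) = 48 * s b := by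
    intro s b; rw [map_smul_eq_mul]; norm_num
  have hit : ∀ n : ℕ, ∀ a ∈ Flk k l, N a ≤ 3 / 2 + B / 48 ^ n := by
    intro n
    induction n with
    | zero => intro a ha; have := hB a ha; simp; linarith
    | succ n ih =>
      intro a ha
      obtain ⟨z, hz, hd⟩ := aux_net k l hl a ha
      have h1 := ih _ hd
      rw [hsc] at h1
      have h2 := abs_le.1 (hZ z hz)
      have h3 := hm1 (lat k l z) (by rw [ZZ, Finset.mem_filter] at hz; exact hz.2.2.2)
      have h4 : N a ≤ N (lat k l z) + N (a - lat k l z) := by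
        have := map_add_le_add N (lat k l z) (a - lat k l z)
        simpa using this
      have h5 : B / 48 ^ (n+1) = (B / 48 ^ n) / 48 := by rw [pow_succ]; field_simp
      rw [h5]; linarith
  have hN2 : ∀ a ∈ Flk k l, N a ≤ 3 / 2 := by
    intro a ha
    have ht : Filter.Tendsto (fun n : ℕ => 3 / 2 + B / 48 ^ n) Filter.atTop (nhds (3/2 + 0)) := by
      refine Filter.Tendsto.const_add _ ?_
      have h7 := (tendsto_pow_atTop_nhds_zero_of_lt_one (show (0:ℝ) ≤ 1/48 by norm_num) (by norm_num)).const_mul B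
      rw [mul_zero] at h7
      refine h7.congr fun n => ?_
      rw [one_div_pow]; ring
    have := ge_of_tendsto' ht (fun n => hit n a ha)
    linarith
  have hunit : ∀ a ∈ Flk k l, ∑ i, a i ^ 2 = 1 → |N a - m a| ≤ m a / 4 := by
    intro a ha h1
    obtain ⟨z, hz, hd⟩ := aux_net k l hl a ha
    have e1 := hN2 _ hd
    have e2 := hm1 _ hd.1
    rw [hsc] at e1 e2
    have e3 := abs_le.1 (hZ z hz)
    have e4 := abs_le.1 (abs_sub_map_le_sub N a (lat k l z))
    have e5 := abs_le.1 (abs_sub_map_le_sub m a (lat k l z))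
    have e6 := hm2 a h1
    rw [abs_le]; constructor <;> linarith [e3.1, e3.2, e4.1, e4.2, e5.1, e5.2]
  by_cases h0 : ∑ i, a i ^ 2 = 0
  · have : a = 0 := by
      funext i
      have := (Finset.sum_eq_zero_iff_of_nonneg (fun i _ => sq_nonneg (a i))).1 h0 i (Finset.mem_univ i)
      simpa using this
    simp [this]
  · set r := Real.sqrt (∑ i, a i ^ 2) with hr
    have hp : 0 < ∑ i, a i ^ 2 := lt_of_le_of_ne (by positivity) (Ne.symm h0)
    have hr0 : 0 < r := Real.sqrt_pos.2 hp
    have hr2 : r ^ 2 = ∑ i, a i ^ 2 := Real.sq_sqrt hp.le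
    have hu : ∑ i, ((r⁻¹ • a) i) ^ 2 = 1 := by
      simp only [Pi.smul_apply, smul_eq_mul, mul_pow]
      rw [← Finset.mul_sum, ← hr2]; field_simp
    have hF : r⁻¹ • a ∈ Flk k l := by
      refine ⟨hu.le, (Finset.card_le_card ?_).trans ha.2⟩
      intro i; simp only [Finset.mem_filter, Finset.mem_univ, true_and]
      intro h h'; apply h; simp [h']
    have := hunit _ hF hu
    rw [map_smul_eq_mul, map_smul_eq_mul, ← mul_sub, abs_mul, Real.norm_eq_abs, abs_abs,
      mul_div_assoc] at this
    exact le_of_mul_le_mul_left this (by positivity)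

lemma aux_wsum (δ : ℝ) (hδ : 0 ≤ δ) (n : ℕ) :
    ∑ z ∈ Finset.Icc (-(n:ℤ)) n, (if z = 0 then 1 else δ * (1/2:ℝ) ^ z.natAbs) ≤ 1 + 2 * δ := by
  have : ∑ z ∈ Finset.Icc (-(n:ℤ)) n, (if z = 0 then 1 else δ * (1/2:ℝ) ^ z.natAbs)
      = 1 + 2 * δ * (1 - (1/2) ^ n) := by
    induction n with
    | zero => simp
    | succ n ih =>
      have e : Finset.Icc (-((n+1:ℕ):ℤ)) ((n+1:ℕ):ℤ) =
          insert (-((n+1:ℕ):ℤ)) (insert ((n+1:ℕ):ℤ) (Finset.Icc (-(n:ℤ)) n)) := by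
        ext x; simp only [Finset.mem_Icc, Finset.mem_insert]; omega
      rw [e, Finset.sum_insert, Finset.sum_insert, ih]
      · have h1 : (-((n+1:ℕ):ℤ)) ≠ 0 := by omega
        have h2 : (((n+1:ℕ):ℤ)) ≠ 0 := by omega
        rw [if_neg h1, if_neg h2, Int.natAbs_neg, Int.natAbs_natCast]
        rw [pow_succ]; ring
      · simp only [Finset.mem_Icc]; omega
      · simp only [Finset.mem_Icc, Finset.mem_insert]; omega
  rw [this]
  have : (0:ℝ) ≤ (1/2) ^ n := by positivity
  nlinarith

lemma aux_card (k l : ℕ) (δ : ℝ) (hδ : 0 < δ) (hδ1 : δ ≤ 1) :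
    ((ZZ k l).card : ℝ) * (δ * (1/2) ^ 48) ^ l ≤ (1 + 2 * δ) ^ k := by
  classical
  set w : ℤ → ℝ := fun z => if z = 0 then 1 else δ * (1/2:ℝ) ^ z.natAbs with hw
  have hw0 : ∀ z, 0 ≤ w z := by intro z; simp only [hw]; split_ifs <;> positivity
  calc ((ZZ k l).card : ℝ) * (δ * (1/2) ^ 48) ^ l = ∑ z ∈ ZZ k l, (δ * (1/2) ^ 48) ^ l := by simp
    _ ≤ ∑ z ∈ ZZ k l, ∏ i, w (z i) := by
        refine Finset.sum_le_sum fun z hz => ?_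
        rw [ZZ, Finset.mem_filter] at hz
        obtain ⟨-, h1, h2, -⟩ := hz
        have : ∏ i, w (z i) = δ ^ (Finset.univ.filter fun i => z i ≠ 0).card * (1/2) ^ ∑ i, (z i).natAbs := by
          rw [← Finset.prod_pow_eq_pow_sum, ← Finset.prod_const, Finset.prod_filter, ← Finset.prod_mul_distrib]
          refine Finset.prod_congr rfl fun i _ => ?_
          by_cases h : z i = 0 <;> simp [hw, h]
        rw [this, mul_pow, ← pow_mul]
        have a1 := pow_le_pow_of_le_one hδ.le hδ1 h1
        have a2 := pow_le_pow_of_le_one (show (0:ℝ) ≤ 1/2 by norm_num) (by norm_num) h2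
        gcongr
    _ ≤ ∑ z ∈ Fintype.piFinset (fun _ : Fin k => Finset.Icc (-(48 * l : ℤ)) (48 * l)), ∏ i, w (z i) := by
        refine Finset.sum_le_sum_of_subset_of_nonneg (Finset.filter_subset _ _) fun z _ _ => ?_
        exact Finset.prod_nonneg fun i _ => hw0 _
    _ = ∏ i : Fin k, ∑ z ∈ Finset.Icc (-(48 * l : ℤ)) (48 * l), w z := by
        rw [Finset.prod_univ_sum]
    _ ≤ (1 + 2 * δ) ^ k := by
        rw [Finset.prod_const, Finset.card_univ, Fintype.card_fin]
        refine pow_le_pow_left₀ (Finset.sum_nonneg fun z _ => hw0 z) ?_ k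
        have := aux_wsum δ hδ.le (48 * l)
        push_cast at this
        exact this

noncomputable def lin {k : ℕ} (a : Fin k → ℝ) (e : Fin k → Bool) : ℝ := ∑ i, a i * sgn (e i)

noncomputable def mu (k : ℕ) (a : Fin k → ℝ) : ℝ := (∑ e : Fin k → Bool, |lin a e|) / 2 ^ k

lemma aux_cons (n : ℕ) (F : (Fin (n+1) → Bool) → ℝ) :
    ∑ e, F e = ∑ e : Fin n → Bool, (F (Fin.cons true e) + F (Fin.cons false e)) := by
  rw [← (Fin.consEquiv (fun _ : Fin (n+1) => Bool)).sum_comp, Fintype.sum_prod_type]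
  simp [Finset.sum_add_distrib, Fin.consEquiv]

lemma lin_cons (n : ℕ) (a : Fin (n+1) → ℝ) (b : Bool) (e : Fin n → Bool) :
    lin a (Fin.cons b e) = a 0 * sgn b + lin (fun i => a i.succ) e := by
  simp [lin, Fin.sum_univ_succ]

lemma mom2 (k : ℕ) (a : Fin k → ℝ) : ∑ e, lin a e ^ 2 = 2 ^ k * ∑ i, a i ^ 2 := by
  induction k with
  | zero => simp [lin]
  | succ n ih =>
    rw [aux_cons, Fin.sum_univ_succ]
    have : ∀ e : Fin n → Bool, lin a (Fin.cons true e) ^ 2 + lin a (Fin.cons false e) ^ 2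
        = 2 * a 0 ^ 2 + 2 * lin (fun i => a i.succ) e ^ 2 := by
      intro e; rw [lin_cons, lin_cons]; simp [sgn]; ring
    simp only [this]
    rw [Finset.sum_add_distrib, ← Finset.mul_sum Finset.univ (fun e => lin (fun i => a i.succ) e ^ 2), ih]
    simp; ring

lemma mom4 (k : ℕ) (a : Fin k → ℝ) : ∑ e, lin a e ^ 4 ≤ 2 ^ k * (3 * (∑ i, a i ^ 2) ^ 2) := by
  induction k with
  | zero => simp [lin]
  | succ n ih =>
    rw [aux_cons, Fin.sum_univ_succ]
    have : ∀ e : Fin n → Bool, lin a (Fin.cons true e) ^ 4 + lin a (Fin.cons false e) ^ 4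
        = 2 * a 0 ^ 4 + 12 * a 0 ^ 2 * lin (fun i => a i.succ) e ^ 2
          + 2 * lin (fun i => a i.succ) e ^ 4 := by
      intro e; rw [lin_cons, lin_cons]; simp [sgn]; ring
    simp only [this]
    rw [Finset.sum_add_distrib, Finset.sum_add_distrib,
      ← Finset.mul_sum Finset.univ (fun e => lin (fun i => a i.succ) e ^ 2),
      ← Finset.mul_sum Finset.univ (fun e => lin (fun i => a i.succ) e ^ 4), mom2]
    have h := ih (fun i => a i.succ)
    simp only [Finset.sum_const, Finset.card_univ, Fintype.card_pi, Fintype.card_bool, Finset.prod_const, Fintype.card_fin, nsmul_eq_mul]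
    push_cast
    have h2 : (0:ℝ) ≤ 2 ^ n * a 0 ^ 4 := by positivity
    rw [pow_succ 2 n]
    nlinarith

lemma mgf (k : ℕ) (a : Fin k → ℝ) (c : ℝ) :
    ∑ e, Real.exp (c * lin a e) ≤ 2 ^ k * Real.exp (c ^ 2 / 2 * ∑ i, a i ^ 2) := by
  induction k with
  | zero => simp [lin]
  | succ n ih =>
    rw [aux_cons, Fin.sum_univ_succ]
    have : ∀ e : Fin n → Bool, Real.exp (c * lin a (Fin.cons true e)) + Real.exp (c * lin a (Fin.cons false e))
        = 2 * Real.cosh (c * a 0) * Real.exp (c * lin (fun i => a i.succ) e) := by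
      intro e; rw [lin_cons, lin_cons, Real.cosh_eq]; simp only [sgn, if_true, mul_add, Real.exp_add]; simp; ring
    simp only [this]
    rw [← Finset.mul_sum]
    have h := ih (fun i => a i.succ)
    have h2 := Real.cosh_le_exp_half_sq (c * a 0)
    calc _ ≤ 2 * Real.exp ((c * a 0) ^ 2 / 2) * (2 ^ n * Real.exp (c ^ 2 / 2 * ∑ i : Fin n, a i.succ ^ 2)) := by
          gcongr
      _ = _ := by rw [mul_add, Real.exp_add]; ring_nf

lemma mu_le (k : ℕ) (a : Fin k → ℝ) (h : ∑ i, a i ^ 2 ≤ 1) : mu k a ≤ 1 := by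
  rw [mu, div_le_one (by positivity)]
  calc ∑ e, |lin a e| ≤ ∑ e : Fin k → Bool, (lin a e ^ 2 * (1/2) + 1/2) := by
        refine Finset.sum_le_sum fun e _ => ?_
        rw [← sq_abs]; nlinarith [sq_nonneg (|lin a e| - 1)]
    _ = 2 ^ k * (∑ i, a i ^ 2) * (1/2) + 2 ^ k * (1/2) := by
        rw [Finset.sum_add_distrib, ← Finset.sum_mul, mom2]; simp
    _ ≤ 2 ^ k := by
        have : (0:ℝ) < 2 ^ k := by positivity
        nlinarith

lemma mu_nonneg (k : ℕ) (a : Fin k → ℝ) : 0 ≤ mu k a := by rw [mu]; positivity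

lemma le_mu (k : ℕ) (a : Fin k → ℝ) (h : ∑ i, a i ^ 2 = 1) : 1 / 2 ≤ mu k a := by
  rw [mu, le_div_iff₀ (by positivity)]
  have h1 : ∑ e : Fin k → Bool, (3 / 4 * lin a e ^ 2 - 1 / 16 * lin a e ^ 4) ≤ ∑ e, |lin a e| := by
    refine Finset.sum_le_sum fun e _ => ?_
    have e4 : lin a e ^ 4 = |lin a e| ^ 4 := by
      rw [show (4:ℕ) = 2 * 2 from rfl, pow_mul, pow_mul, sq_abs]
    rw [e4, ← sq_abs]
    have := abs_nonneg (lin a e)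
    have h3 : 0 ≤ |lin a e| * ((|lin a e| - 2) ^ 2 * (|lin a e| + 4)) := by positivity
    nlinarith
  rw [Finset.sum_sub_distrib, ← Finset.mul_sum, ← Finset.mul_sum, mom2, h] at h1
  have h4 := mom4 k a
  rw [h] at h4
  have : (0:ℝ) < 2 ^ k := by positivity
  linarith

lemma exp_bd (x : ℝ) : Real.exp x ≤ 1 + x + x ^ 2 * Real.exp |x| := by
  rcases le_or_gt |x| 1 with h | h
  · have h1 := abs_le.1 (Real.abs_exp_sub_one_sub_id_le h)
    have h2 : 1 ≤ Real.exp |x| := Real.one_le_exp (abs_nonneg x)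
    nlinarith [sq_nonneg x]
  · rcases le_total 0 x with h0 | h0
    · rw [abs_of_nonneg h0] at h ⊢
      have h3 : 0 ≤ (x ^ 2 - 1) * Real.exp x := mul_nonneg (by nlinarith) (Real.exp_pos x).le
      nlinarith [Real.exp_pos x]
    · have h2 : 1 ≤ Real.exp |x| := Real.one_le_exp (abs_nonneg x)
      rw [abs_of_nonpos h0] at h h2 ⊢
      have : Real.exp x ≤ 1 := Real.exp_le_one_iff.2 h0
      nlinarith [sq_nonneg x]

lemma exp_bd2 (c y : ℝ) (hc : |c| ≤ 1) :
    Real.exp (c * y) ≤ 1 + c * y + 2 * c ^ 2 * Real.exp (2 * |y|) := by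
  refine (exp_bd (c * y)).trans ?_
  have h1 : |c * y| ≤ |y| := by rw [abs_mul]; nlinarith [abs_nonneg y]
  have h2 : y ^ 2 ≤ 2 * Real.exp |y| := by
    have := Real.quadratic_le_exp_of_nonneg (abs_nonneg y)
    rw [sq_abs] at this
    nlinarith [abs_nonneg y]
  have h3 : Real.exp (2 * |y|) = Real.exp |y| * Real.exp |y| := by rw [← Real.exp_add]; ring_nf
  have h4 := Real.exp_le_exp.2 h1
  have : (c * y) ^ 2 * Real.exp |c * y| ≤ c ^ 2 * (2 * Real.exp |y|) * Real.exp |y| := by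
    rw [mul_pow]; gcongr
  rw [h3]; linarith

lemma col_mgf (k : ℕ) (a : Fin k → ℝ) (h : ∑ i, a i ^ 2 ≤ 1) (c : ℝ) (hc : |c| ≤ 1) :
    ∑ e, Real.exp (c * (|lin a e| - mu k a)) ≤ 2 ^ k * Real.exp (4 * Real.exp 4 * c ^ 2) := by
  have hp : (0:ℝ) < 2 ^ k := by positivity
  have hm := mu_le k a h
  have hm0 := mu_nonneg k a
  have hA : ∀ e, Real.exp (c * (|lin a e| - mu k a)) ≤
      1 + c * (|lin a e| - mu k a) + 2 * c ^ 2 * Real.exp 2 * (Real.exp (2 * lin a e) + Real.exp ((-2) * lin a e)) := by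
    intro e
    refine (exp_bd2 _ _ hc).trans ?_
    have h1 : |(|lin a e| - mu k a)| ≤ |lin a e| + 1 := by
      rw [abs_le]; constructor <;> linarith [abs_nonneg (lin a e)]
    have h2 : Real.exp (2 * |(|lin a e| - mu k a)|) ≤ Real.exp 2 * Real.exp (2 * |lin a e|) := by
      rw [← Real.exp_add]; apply Real.exp_le_exp.2; linarith
    have h3 : Real.exp (2 * |lin a e|) ≤ Real.exp (2 * lin a e) + Real.exp ((-2) * lin a e) := by
      rcases abs_cases (lin a e) with ⟨h, _⟩ | ⟨h, _⟩ <;> rw [h]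
      · linarith [Real.exp_pos ((-2) * lin a e)]
      · rw [show 2 * -lin a e = (-2) * lin a e by ring]; linarith [Real.exp_pos (2 * lin a e)]
    have h4 : Real.exp (2 * |(|lin a e| - mu k a)|) ≤ Real.exp 2 * (Real.exp (2 * lin a e) + Real.exp ((-2) * lin a e)) :=
      h2.trans (by gcongr)
    have h5 := mul_le_mul_of_nonneg_left h4 (show 0 ≤ 2 * c ^ 2 by positivity)
    linarith
  have hB : ∑ e, (|lin a e| - mu k a) = 0 := by
    rw [Finset.sum_sub_distrib]
    simp [mu]
    field_simp
    simp
  have g1 : ∑ e, Real.exp (2 * lin a e) ≤ 2 ^ k * Real.exp 2 := by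
    refine (mgf k a 2).trans ?_
    gcongr; linarith
  have g2 : ∑ e, Real.exp ((-2) * lin a e) ≤ 2 ^ k * Real.exp 2 := by
    refine (mgf k a (-2)).trans ?_
    gcongr; linarith
  calc _ ≤ ∑ e, (1 + c * (|lin a e| - mu k a) + 2 * c ^ 2 * Real.exp 2 * (Real.exp (2 * lin a e) + Real.exp ((-2) * lin a e))) :=
        Finset.sum_le_sum fun e _ => hA e
    _ = 2 ^ k + 2 * c ^ 2 * Real.exp 2 * (∑ e, Real.exp (2 * lin a e) + ∑ e, Real.exp ((-2) * lin a e)) := by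
        rw [Finset.sum_add_distrib, Finset.sum_add_distrib, ← Finset.mul_sum, ← Finset.mul_sum, hB, Finset.sum_add_distrib]
        simp
    _ ≤ 2 ^ k + 2 * c ^ 2 * Real.exp 2 * (2 ^ k * Real.exp 2 + 2 ^ k * Real.exp 2) := by gcongr
    _ = 2 ^ k * (4 * Real.exp 4 * c ^ 2 + 1) := by
        rw [show (4:ℝ) = 2 + 2 by norm_num, Real.exp_add]; ring
    _ ≤ _ := by gcongr; exact Real.add_one_le_exp _

lemma swap_sum (k : ℕ) (F : (Fin k → Fin k → Bool) → ℝ) :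
    ∑ ε, F ε = ∑ ε : Fin k → Fin k → Bool, F (fun i j => ε j i) :=
  ((Equiv.piComm (fun (_ _ : Fin k) => Bool)).sum_comp F).symm

lemma prod_sum' (k : ℕ) (g : Fin k → (Fin k → Bool) → ℝ) :
    ∑ ε : Fin k → Fin k → Bool, ∏ j, g j (ε j) = ∏ j, ∑ e, g j e := by
  rw [Finset.prod_univ_sum, Fintype.piFinset_univ]

lemma E1_eq (k : ℕ) (hk : 0 < k) (a : Fin k → ℝ) : E1 k a = mu k a := by
  classical
  rw [E1, swap_sum, ← Finset.mul_sum, Finset.sum_comm]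
  have h : ∀ j : Fin k, ∑ ε : Fin k → Fin k → Bool, |∑ i, a i * sgn (ε j i)| = 2 ^ (k * k) * mu k a := by
    intro j
    have := prod_sum' k (fun j' e => if j' = j then |lin a e| else 1)
    simp only [Finset.prod_ite_eq', Finset.mem_univ, if_true] at this
    rw [show (∑ ε : Fin k → Fin k → Bool, |∑ i, a i * sgn (ε j i)|) = ∑ ε : Fin k → Fin k → Bool, |lin a (ε j)| from rfl]
    rw [this, ← Finset.mul_prod_erase _ _ (Finset.mem_univ j)]
    rw [Finset.prod_congr (g := fun _ => (2:ℝ) ^ k) rfl]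
    · rw [Finset.prod_const, Finset.card_erase_of_mem (Finset.mem_univ j)]
      simp only [if_true, Finset.card_univ, Fintype.card_fin, mu]
      obtain ⟨n, rfl⟩ : ∃ n, k = n + 1 := ⟨k - 1, by omega⟩
      simp only [Nat.add_sub_cancel]
      rw [pow_mul, pow_succ ((2:ℝ) ^ (n+1)) n]
      field_simp
    · intro x hx
      simp [Finset.ne_of_mem_erase hx]
  simp only [h]
  have : (k:ℝ) ≠ 0 := by positivity
  simp; field_simp

noncomputable def nn (k : ℕ) (a : Fin k → ℝ) (ε : Fin k → Fin k → Bool) : ℝ :=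
  (k : ℝ)⁻¹ * ∑ j, |∑ i, a i * sgn (ε i j)|

lemma chern (k : ℕ) (hk : 0 < k) (a : Fin k → ℝ) (h : ∑ i, a i ^ 2 ≤ 1) (c : ℝ) (hc : |c| ≤ 1) (t : ℝ) :
    ∑ ε, Real.exp (c * k * (nn k a ε - mu k a) - k * t) ≤ 2 ^ (k * k) * Real.exp (k * (4 * Real.exp 4 * c ^ 2 - t)) := by
  rw [swap_sum]
  have hk' : (k:ℝ) ≠ 0 := by positivity
  have : ∀ ε : Fin k → Fin k → Bool, Real.exp (c * k * (nn k a (fun i j => ε j i) - mu k a) - k * t)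
      = Real.exp (-(k * t)) * ∏ j, Real.exp (c * (|lin a (ε j)| - mu k a)) := by
    intro ε
    rw [← Real.exp_sum, ← Real.exp_add]
    congr 1
    rw [← Finset.mul_sum, Finset.sum_sub_distrib]
    simp only [nn, lin, Finset.sum_const, Finset.card_univ, Fintype.card_fin, nsmul_eq_mul]
    field_simp
    ring
  simp only [this]
  rw [← Finset.mul_sum, prod_sum' k (fun _ e => Real.exp (c * (|lin a e| - mu k a))), Finset.prod_const, Finset.card_univ, Fintype.card_fin]
  have h1 := pow_le_pow_left₀ (Finset.sum_nonneg fun e _ => (Real.exp_pos _).le) (col_mgf k a h c hc) k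
  refine (mul_le_mul_of_nonneg_left h1 (Real.exp_pos _).le).trans (le_of_eq ?_)
  rw [mul_pow, ← pow_mul, ← Real.exp_nat_mul, mul_left_comm, ← Real.exp_add]
  congr 2; ring

noncomputable def pp : ℝ := (1/16) ^ 2 / (4 * (4 * Real.exp 4))

lemma conc (k : ℕ) (hk : 0 < k) (a : Fin k → ℝ) (h : ∑ i, a i ^ 2 ≤ 1) [DecidablePred fun ε => 1 / 16 < |nn k a ε - mu k a|] :
    ((Finset.univ.filter fun ε => 1 / 16 < |nn k a ε - mu k a|).card : ℝ) ≤
      2 ^ (k * k) * (2 * Real.exp (-(pp * k))) := by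
  set C : ℝ := 4 * Real.exp 4 with hC
  have hC1 : 1 ≤ C := by have := Real.add_one_le_exp 4; rw [hC]; linarith
  set c : ℝ := (1/16) / (2 * C) with hc
  have hc0 : 0 < c := by positivity
  have hc1 : |c| ≤ 1 := by
    rw [abs_of_pos hc0, hc, div_le_one (by positivity)]; linarith
  have e1 := chern k hk a h c hc1 (c * (1/16))
  have e2 := chern k hk a h (-c) (by rwa [abs_neg]) (c * (1/16))
  have ee : (k:ℝ) * (4 * Real.exp 4 * c ^ 2 - c * (1/16)) = -(pp * k) := by
    rw [pp, ← hC, hc]; field_simp; ring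
  rw [neg_sq, ee] at e2
  rw [ee] at e1
  rw [Finset.card_filter]; push_cast
  calc _ ≤ ∑ ε, (Real.exp (c * k * (nn k a ε - mu k a) - k * (c * (1/16))) + Real.exp (-c * k * (nn k a ε - mu k a) - k * (c * (1/16)))) := by
        refine Finset.sum_le_sum fun ε _ => ?_
        have hk' : (0:ℝ) < c * k := by positivity
        split_ifs with hh
        · rcases lt_abs.1 hh with h' | h'
          · have : 1 ≤ Real.exp (c * k * (nn k a ε - mu k a) - k * (c * (1/16))) := by
              apply Real.one_le_exp; nlinarith
            linarith [Real.exp_pos (-c * k * (nn k a ε - mu k a) - k * (c * (1/16)))]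
          · have : 1 ≤ Real.exp (-c * k * (nn k a ε - mu k a) - k * (c * (1/16))) := by
              apply Real.one_le_exp; nlinarith
            linarith [Real.exp_pos (c * k * (nn k a ε - mu k a) - k * (c * (1/16)))]
        · positivity
    _ ≤ _ := by rw [Finset.sum_add_distrib]; linarith

noncomputable def nS (k : ℕ) (ε : Fin k → Fin k → Bool) : Seminorm ℝ (Fin k → ℝ) :=
  Seminorm.of (fun a => nn k a ε)
    (by
      intro a b
      simp only [nn]
      rw [← mul_add, ← Finset.sum_add_distrib]
      gcongr with j _
      simp only [Pi.add_apply, add_mul, Finset.sum_add_distrib]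
      exact abs_add_le _ _)
    (by
      intro c a
      simp only [nn, Pi.smul_apply, smul_eq_mul, mul_assoc, ← Finset.mul_sum, abs_mul, Real.norm_eq_abs]
      ring)

noncomputable def mS (k : ℕ) : Seminorm ℝ (Fin k → ℝ) :=
  Seminorm.of (fun a => mu k a)
    (by
      intro a b
      simp only [mu]
      rw [← add_div, ← Finset.sum_add_distrib]
      gcongr with j _
      simp only [lin, Pi.add_apply, add_mul, Finset.sum_add_distrib]
      exact abs_add_le _ _)
    (by
      intro c a
      simp only [mu, lin, Pi.smul_apply, smul_eq_mul, mul_assoc, ← Finset.mul_sum, abs_mul, Real.norm_eq_abs]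
      ring)

lemma nn_bd (k : ℕ) (hk : 0 < k) (ε : Fin k → Fin k → Bool) (a : Fin k → ℝ) (h : ∑ i, a i ^ 2 ≤ 1) :
    nn k a ε ≤ k := by
  have hk' : (k:ℝ) ≠ 0 := by positivity
  have h1 : ∀ j, |∑ i, a i * sgn (ε i j)| ≤ k := by
    intro j
    refine (Finset.abs_sum_le_sum_abs _ _).trans ?_
    have : ∀ i ∈ (Finset.univ : Finset (Fin k)), |a i * sgn (ε i j)| ≤ 1 := by
      intro i _
      have e : |sgn (ε i j)| = 1 := by rw [sgn]; split_ifs <;> simp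
      rw [abs_mul, e, mul_one]
      have := (Finset.single_le_sum (f := fun i => a i ^ 2) (fun i _ => sq_nonneg _) (Finset.mem_univ i)).trans h
      exact (sq_le_one_iff_abs_le_one _).1 this
    refine (Finset.sum_le_sum this).trans ?_
    simp
  rw [nn]
  have h2 : ∑ j, |∑ i, a i * sgn (ε i j)| ≤ ∑ j : Fin k, (k:ℝ) := Finset.sum_le_sum fun j _ => h1 j
  calc _ ≤ (k:ℝ)⁻¹ * ∑ j : Fin k, (k:ℝ) := by gcongr
    _ = k := by simp; field_simp

lemma pp_pos : 0 < pp := by rw [pp]; positivity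

lemma pp_le : pp ≤ 1 := by
  rw [pp, div_le_one (by positivity)]
  have := Real.add_one_le_exp 4
  linarith

/-- There are absolute positive constants `η` and `α` such that for every positive integer `k`
and every `l ≤ α k`,
`P(∃ a ∈ F_l^k, |k⁻¹ ∑_j |∑_i a_i ε_{i,j}| − E₁(a)| > E₁(a)/4) ≤ e^{−η k}`. -/
theorem stmt3 :
    ∃ η α : ℝ, 0 < η ∧ 0 < α ∧ ∀ k : ℕ, 0 < k → ∀ l : ℕ, (l : ℝ) ≤ α * k →
      signProb k (fun ε => ∃ a ∈ Flk k l,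
          |(k : ℝ)⁻¹ * ∑ j, |∑ i, a i * sgn (ε i j)| - E1 k a| > E1 k a / 4)
        ≤ Real.exp (-(η * k)) := by
  classical
  have hp := pp_pos
  have hp1 := pp_le
  set δ : ℝ := pp / 8 with hδ
  have hδ0 : 0 < δ := by positivity
  have hδ1 : δ ≤ 1 := by linarith
  set q : ℝ := δ * (1/2) ^ 48 with hq
  have hq0 : 0 < q := by positivity
  have hq1 : q ≤ 1 := mul_le_one₀ hδ1 (by positivity) (pow_le_one₀ (by norm_num) (by norm_num))
  set K : ℝ := - Real.log q with hK
  have hK0 : 0 ≤ K := by rw [hK]; linarith [Real.log_nonpos hq0.le hq1]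
  have hqK : q = Real.exp (-K) := by rw [hK, neg_neg, Real.exp_log hq0]
  refine ⟨pp / 4, pp / 4 / (1 + K), by positivity, by positivity, ?_⟩
  intro k hk l hlk
  have hk0 : (0:ℝ) < k := by exact_mod_cast hk
  rw [signProb, div_le_iff₀ (by positivity)]
  rcases Nat.eq_zero_or_pos l with h0 | hl
  · rw [Finset.filter_eq_empty_iff.2]
    · simp; positivity
    · rintro ε - ⟨a, ⟨-, ha⟩, hh⟩
      subst h0
      have ha0 : ∀ i, a i = 0 := by
        intro i
        by_contra hne
        have : i ∈ Finset.univ.filter (fun i => a i ≠ 0) := by simp [hne]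
        rw [Finset.card_eq_zero.1 (Nat.le_zero.1 ha)] at this
        simp at this
      have : a = 0 := funext ha0
      subst this
      simp [E1] at hh
  have hl1 : (1:ℝ) ≤ l := by exact_mod_cast hl
  have hsub : (Finset.univ.filter fun ε : Fin k → Fin k → Bool => ∃ a ∈ Flk k l,
          |(k : ℝ)⁻¹ * ∑ j, |∑ i, a i * sgn (ε i j)| - E1 k a| > E1 k a / 4) ⊆
      (ZZ k l).biUnion fun z => Finset.univ.filter fun ε => 1 / 16 < |nn k (lat k l z) ε - mu k (lat k l z)| := by
    intro ε hε
    rw [Finset.mem_filter] at hε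
    obtain ⟨-, a, ha, hh⟩ := hε
    by_contra hne
    simp only [Finset.mem_biUnion, Finset.mem_filter, Finset.mem_univ, true_and, not_exists, not_and, not_lt] at hne
    have := aux_det k l hl (nS k ε) (mS k) k (fun a ha => nn_bd k hk ε a ha.1) (mu_le k) (le_mu k) hne a ha
    rw [E1_eq k hk] at hh
    exact absurd this (not_le.2 hh)
  have hb : (((ZZ k l).biUnion fun z => Finset.univ.filter fun ε => 1 / 16 < |nn k (lat k l z) ε - mu k (lat k l z)|).card : ℝ)
      ≤ (ZZ k l).card * (2 ^ (k * k) * (2 * Real.exp (-(pp * k)))) := by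
    refine (Nat.cast_le.2 Finset.card_biUnion_le).trans ?_
    push_cast
    rw [← nsmul_eq_mul]
    refine Finset.sum_le_card_nsmul _ _ _ fun z hz => ?_
    rw [ZZ, Finset.mem_filter] at hz
    exact conc k hk _ hz.2.2.2
  have hcard : ((ZZ k l).card : ℝ) ≤ Real.exp (pp / 4 * k + K * l) := by
    have h1 := aux_card k l δ hδ0 hδ1
    rw [← hq, hqK, ← Real.exp_nat_mul] at h1
    have h2 : (1 + 2 * δ) ^ k ≤ Real.exp (pp / 4 * k) := by
      have : 1 + 2 * δ ≤ Real.exp (pp / 4) := by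
        have := Real.add_one_le_exp (pp / 4); rw [hδ]; linarith
      calc _ ≤ Real.exp (pp / 4) ^ k := pow_le_pow_left₀ (by positivity) this k
        _ = _ := by rw [← Real.exp_nat_mul]; ring_nf
    have h3 : ((ZZ k l).card : ℝ) = ((ZZ k l).card * Real.exp (l * -K)) * Real.exp (K * l) := by
      rw [mul_assoc, ← Real.exp_add]; ring_nf; simp
    rw [h3, Real.exp_add]
    gcongr
    exact h1.trans h2
  have hfin : l * (1 + K) ≤ pp / 4 * k := by
    rw [div_mul_eq_mul_div, le_div_iff₀ (by positivity)] at hlk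
    exact hlk
  have h2e : (2:ℝ) ≤ Real.exp l := by
    have := Real.add_one_le_exp (l:ℝ); linarith
  calc _ ≤ (((ZZ k l).biUnion fun z => Finset.univ.filter fun ε => 1 / 16 < |nn k (lat k l z) ε - mu k (lat k l z)|).card : ℝ) := by
        refine Nat.cast_le.2 ((Finset.card_le_card ?_))
        convert hsub
    _ ≤ _ := hb
    _ ≤ Real.exp (pp / 4 * k + K * l) * (2 ^ (k * k) * (Real.exp l * Real.exp (-(pp * k)))) := by gcongr
    _ = Real.exp (pp / 4 * k + K * l + l - pp * k) * 2 ^ (k * k) := by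
        rw [sub_eq_add_neg, Real.exp_add _ (-(pp * k)), Real.exp_add _ (l:ℝ)]; ring
    _ ≤ _ := by
        gcongr
        have : (0:ℝ) < pp * k := by positivity
        nlinarith
end

section
/- Let a = (a_1,…,a_k) ∈ ℝ^k with ‖a‖₂ = 1 and let 0 < γ < 1. If k^{-1/2} Σ_{i=1}^k |a_i| ≤ γ, then for every 1 ≤ l ≤ k one has (Σ_{i=l}^k (a_i*)²)^{1/2} ≤ l^{-1} γ √(k(k−l+1)), where {a_i*}_{i=1}^k denotes the decreasing rearrangement of {|a_i|}_{i=1}^k. -/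
open Finset

/-- Let `a ∈ ℝ^k` with `‖a‖₂ = 1` and `0 < γ < 1`. If `k^{-1/2} ∑_i |a_i| ≤ γ`, then for
every `1 ≤ l ≤ k`, `(∑_{i=l}^k (a_i*)²)^{1/2} ≤ l⁻¹ γ √(k(k−l+1))`, where `{a_i*}` is the
decreasing rearrangement of `{|a_i|}` (here represented by an antitone function `b` obtained
from `|a|` by a permutation `σ`; indices of `b` are `0`-based, so `b (i)` corresponds to
`a_{i+1}*`). -/
theorem stmt5 (k : ℕ) (hk : 0 < k) (a : Fin k → ℝ) (ha : ∑ i, a i ^ 2 = 1)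
    (γ : ℝ) (hγ0 : 0 < γ) (hγ1 : γ < 1)
    (hL1 : (Real.sqrt k)⁻¹ * ∑ i, |a i| ≤ γ)
    (b : Fin k → ℝ) (hmono : Antitone b)
    (σ : Equiv.Perm (Fin k)) (hb : ∀ i, b i = |a (σ i)|)
    (l : ℕ) (hl1 : 1 ≤ l) (hlk : l ≤ k) :
    Real.sqrt (∑ i ∈ Finset.univ.filter (fun i : Fin k => l ≤ (i : ℕ) + 1), b i ^ 2)
      ≤ (l : ℝ)⁻¹ * γ * Real.sqrt (k * ((k : ℝ) - l + 1)) := by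
  have hkpos : (0 : ℝ) < k := by exact_mod_cast hk
  have hlpos : (0 : ℝ) < l := by exact_mod_cast hl1
  have hb0 : ∀ i, 0 ≤ b i := fun i => by rw [hb]; exact abs_nonneg _
  have hsum : ∑ i, b i ≤ Real.sqrt k * γ := by
    have h1 : ∑ i, b i = ∑ i, |a i| := by
      simp only [hb]
      exact Equiv.sum_comp σ (fun i => |a i|)
    rw [h1]
    exact (inv_mul_le_iff₀ (Real.sqrt_pos.mpr hkpos)).mp hL1
  let m : Fin k := ⟨l - 1, by omega⟩
  have hm : (l : ℝ) * b m ≤ Real.sqrt k * γ := by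
    have h2 : ∑ i ∈ Finset.Iic m, b m ≤ ∑ i ∈ Finset.Iic m, b i :=
      Finset.sum_le_sum fun i hi => hmono (Finset.mem_Iic.mp hi)
    have h3 : ∑ i ∈ Finset.Iic m, b i ≤ ∑ i, b i :=
      Finset.sum_le_sum_of_subset_of_nonneg (Finset.subset_univ _) fun i _ _ => hb0 i
    rw [Finset.sum_const, Fin.card_Iic, nsmul_eq_mul] at h2
    have h4 : (m : ℕ) + 1 = l := by simp only [m]; omega
    rw [h4] at h2
    linarith
  have hfil : Finset.univ.filter (fun i : Fin k => l ≤ (i : ℕ) + 1) = Finset.Ici m := by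
    ext i
    simp only [Finset.mem_filter, Finset.mem_univ, true_and, Finset.mem_Ici, Fin.le_def, m]
    omega
  have hB : b m ≤ (l : ℝ)⁻¹ * γ * Real.sqrt k := by
    rw [mul_assoc, le_inv_mul_iff₀ hlpos]
    linarith
  have hcard : ((Finset.Ici m).card : ℝ) = (k : ℝ) - l + 1 := by
    rw [Fin.card_Ici]
    have : k - (m : ℕ) + l = k + 1 := by simp only [m]; omega
    have h5 : ((k - (m : ℕ) : ℕ) : ℝ) + l = k + 1 := by exact_mod_cast this
    linarith
  have hc0 : (0 : ℝ) ≤ (k : ℝ) - l + 1 := by rw [← hcard]; positivity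
  rw [hfil, Real.sqrt_mul hkpos.le, ← mul_assoc]
  have hle : ∑ i ∈ Finset.Ici m, b i ^ 2 ≤ (b m) ^ 2 * ((k : ℝ) - l + 1) := by
    have h6 : ∑ i ∈ Finset.Ici m, b i ^ 2 ≤ ∑ i ∈ Finset.Ici m, b m ^ 2 :=
      Finset.sum_le_sum fun i hi =>
        pow_le_pow_left₀ (hb0 i) (hmono (Finset.mem_Ici.mp hi)) 2
    rw [Finset.sum_const, nsmul_eq_mul, hcard] at h6
    linarith
  calc Real.sqrt (∑ i ∈ Finset.Ici m, b i ^ 2)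
      ≤ Real.sqrt ((b m) ^ 2 * ((k : ℝ) - l + 1)) := Real.sqrt_le_sqrt hle
    _ = b m * Real.sqrt ((k : ℝ) - l + 1) := by
        rw [Real.sqrt_mul (sq_nonneg _), Real.sqrt_sq (hb0 m)]
    _ ≤ _ := mul_le_mul_of_nonneg_right hB (Real.sqrt_nonneg _)
end

section
/- For every 0 < γ < 1 and every positive integer k, for every 1 ≤ l ≤ k one has the inclusion A_γ^k ⊆ F_l^k + δ B₂^k, where δ = l^{-1} γ √(k(k−l+1)); that is, every a ∈ A_γ^k can be written as a = b + c with b ∈ F_l^k and ‖c‖₂ ≤ δ. -/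
open Finset

/-- `A_γ^k`: unit vectors `a` of `ℝ^k` with `k^{-1/2} ∑_i |a_i| ≤ γ`. -/
def Agk (k : ℕ) (γ : ℝ) : Set (Fin k → ℝ) :=
  {a | (∑ i, a i ^ 2) = 1 ∧ (Real.sqrt k)⁻¹ * ∑ i, |a i| ≤ γ}

theorem exists_top {k : ℕ} (f : Fin k → ℝ) (l : ℕ) (hl : l ≤ k) :
    ∃ S : Finset (Fin k), S.card = l ∧ ∀ i ∈ S, ∀ j, j ∉ S → f j ≤ f i := by
  induction l with
  | zero => exact ⟨∅, by simp, by simp⟩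
  | succ n ih =>
    obtain ⟨S, hS, h⟩ := ih (by omega)
    have hne : (Sᶜ).Nonempty := by
      rw [← Finset.card_pos, Finset.card_compl, Fintype.card_fin]
      omega
    obtain ⟨m, hm, hmax⟩ := Finset.exists_max_image Sᶜ f hne
    rw [Finset.mem_compl] at hm
    refine ⟨insert m S, by rw [Finset.card_insert_of_notMem hm, hS], ?_⟩
    intro i hi j hj
    rw [Finset.mem_insert, not_or] at hj
    rcases Finset.mem_insert.1 hi with rfl | hi
    · exact hmax j (Finset.mem_compl.2 hj.2)
    · exact h i hi j hj.2

/-- For every `0 < γ < 1`, every positive integer `k` and every `1 ≤ l ≤ k`, one has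
`A_γ^k ⊆ F_l^k + δ B₂^k` where `δ = l⁻¹ γ √(k(k−l+1))`: every `a ∈ A_γ^k` can be written
as `a = b + c` with `b ∈ F_l^k` and `‖c‖₂ ≤ δ`. -/
theorem stmt6 (γ : ℝ) (hγ0 : 0 < γ) (hγ1 : γ < 1) (k : ℕ) (hk : 0 < k)
    (l : ℕ) (hl1 : 1 ≤ l) (hlk : l ≤ k) (a : Fin k → ℝ) (ha : a ∈ Agk k γ) :
    ∃ b c : Fin k → ℝ, b ∈ Flk k l ∧
      Real.sqrt (∑ i, c i ^ 2) ≤ (l : ℝ)⁻¹ * γ * Real.sqrt (k * ((k : ℝ) - l + 1)) ∧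
      a = b + c := by
  obtain ⟨h1, h2⟩ := ha
  obtain ⟨S, hS, h⟩ := exists_top (fun i => |a i|) l hlk
  have hlpos : (0 : ℝ) < l := by exact_mod_cast hl1
  have hkpos : (0 : ℝ) < k := by exact_mod_cast hk
  have hlk' : (l : ℝ) ≤ k := by exact_mod_cast hlk
  have hsum : ∑ i, |a i| ≤ γ * Real.sqrt k := by
    have hs : 0 < Real.sqrt k := Real.sqrt_pos.2 hkpos
    rwa [inv_mul_le_iff₀ hs, mul_comm] at h2
  have hb : ∀ j, j ∉ S → a j ^ 2 ≤ ((l : ℝ)⁻¹ * γ) ^ 2 * k := by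
    intro j hj
    have e1 : (l : ℝ) * |a j| ≤ γ * Real.sqrt k := by
      calc (l : ℝ) * |a j| = ∑ i ∈ S, |a j| := by simp [hS]
        _ ≤ ∑ i ∈ S, |a i| := Finset.sum_le_sum fun i hi => h i hi j hj
        _ ≤ ∑ i, |a i| := Finset.sum_le_sum_of_subset_of_nonneg (Finset.subset_univ _)
            (fun _ _ _ => abs_nonneg _)
        _ ≤ _ := hsum
    have e2 : |a j| ≤ (l : ℝ)⁻¹ * γ * Real.sqrt k := by
      rw [mul_assoc, ← div_eq_inv_mul, le_div_iff₀ hlpos, mul_comm]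
      exact e1
    have e3 := pow_le_pow_left₀ (abs_nonneg _) e2 2
    rwa [sq_abs, mul_pow, Real.sq_sqrt hkpos.le] at e3
  refine ⟨fun i => if i ∈ S then a i else 0, fun i => if i ∈ S then 0 else a i, ⟨?_, ?_⟩, ?_, ?_⟩
  · rw [← h1]
    apply Finset.sum_le_sum
    intro i _
    dsimp only
    split_ifs
    · exact le_rfl
    · simpa using sq_nonneg (a i)
  · rw [← hS]
    apply Finset.card_le_card
    intro i hi
    by_contra hc
    simp [hc] at hi
  · apply Real.sqrt_le_iff.2
    refine ⟨by positivity, ?_⟩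
    rw [mul_pow, Real.sq_sqrt (mul_nonneg hkpos.le (by linarith))]
    have e : ∑ i, (if i ∈ S then 0 else a i) ^ 2 = ∑ i ∈ Sᶜ, a i ^ 2 := by
      rw [← Finset.sum_add_sum_compl S]
      rw [Finset.sum_eq_zero (s := S) (fun i hi => by simp [hi]), zero_add]
      exact Finset.sum_congr rfl fun i hi => by simp [Finset.mem_compl.1 hi]
    rw [e]
    have e4 := Finset.sum_le_card_nsmul Sᶜ (fun i => a i ^ 2) _
      (fun i hi => hb i (Finset.mem_compl.1 hi))
    rw [Finset.card_compl, Fintype.card_fin, hS, nsmul_eq_mul, Nat.cast_sub hlk] at e4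
    have : 0 ≤ ((l : ℝ)⁻¹ * γ) ^ 2 * k := by positivity
    linarith
  · funext i
    by_cases hi : i ∈ S <;> simp [hi]
end

section
/- There are absolute constants 0 < γ < 1 and η > 0 such that for every positive integer k, the probability (with respect to P) that there exists some a ∈ A_γ^k with |(k^{-1} Σ_{j=1}^k (Σ_{i=1}^k a_i ε_{i,j})²)^{1/2} − 1| > 1/2 is at most e^{−η k}. -/
open Finset

lemma sum_peel (n : ℕ) (F : (Fin (n+1) → Bool) → ℝ) :
    ∑ σ, F σ = ∑ τ : Fin n → Bool, (F (Fin.cons true τ) + F (Fin.cons false τ)) := by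
  rw [← (Fin.consEquiv (fun _ : Fin (n+1) => Bool)).sum_comp, Fintype.sum_prod_type,
    Fintype.sum_bool, ← Finset.sum_add_distrib]
  rfl

lemma second_moment (n : ℕ) : ∀ (u : Fin n → ℝ) (x : ℝ),
    ∑ σ : Fin n → Bool, (x + ∑ i, u i * sgn (σ i)) ^ 2 = 2 ^ n * (x ^ 2 + ∑ i, u i ^ 2) := by
  induction n with
  | zero => intro u x; simp
  | succ n ih =>
    intro u x
    rw [sum_peel]
    simp only [Fin.sum_univ_succ, Fin.cons_zero, Fin.cons_succ, sum_add_distrib]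
    have h1 := ih (fun i => u i.succ) (x + u 0 * sgn true)
    have h2 := ih (fun i => u i.succ) (x + u 0 * sgn false)
    simp only [add_assoc] at h1 h2 ⊢
    rw [h1, h2]
    simp only [sgn]
    norm_num
    ring

lemma one_step (x u D : ℝ) (hD : 2 + 2 * u ^ 2 ≤ D) :
    Real.exp ((x + u) ^ 2 / D) + Real.exp ((x - u) ^ 2 / D) ≤
      2 * (Real.exp (u ^ 2 / 2) * Real.exp (x ^ 2 / (D - 2 * u ^ 2))) := by
  have hD0 : 2 ≤ D := by nlinarith [sq_nonneg u]
  have hE0 : 2 ≤ D - 2 * u ^ 2 := by linarith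
  have e1 : Real.exp ((x + u) ^ 2 / D) + Real.exp ((x - u) ^ 2 / D) =
      2 * (Real.exp ((x ^ 2 + u ^ 2) / D) * Real.cosh (2 * x * u / D)) := by
    rw [Real.cosh_eq]
    have : 2 * (Real.exp ((x ^ 2 + u ^ 2) / D) * ((Real.exp (2 * x * u / D) + Real.exp (-(2 * x * u / D))) / 2))
      = Real.exp ((x ^ 2 + u ^ 2) / D) * Real.exp (2 * x * u / D) + Real.exp ((x ^ 2 + u ^ 2) / D) * Real.exp (-(2 * x * u / D)) := by ring
    rw [this, ← Real.exp_add, ← Real.exp_add]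
    congr 2 <;> ring
  rw [e1]
  have h2 := Real.cosh_le_exp_half_sq (2 * x * u / D)
  refine mul_le_mul_of_nonneg_left ?_ (by norm_num)
  refine (mul_le_mul_of_nonneg_left h2 (Real.exp_pos _).le).trans ?_
  rw [← Real.exp_add, ← Real.exp_add]
  apply Real.exp_le_exp.mpr
  have h3 : u ^ 2 / D ≤ u ^ 2 / 2 := div_le_div_of_nonneg_left (sq_nonneg u) (by norm_num) hD0
  have h4 : 1 / D + 2 * u ^ 2 / D ^ 2 ≤ 1 / (D - 2 * u ^ 2) := by
    rw [div_add_div _ _ (by positivity) (by positivity), div_le_div_iff₀ (by positivity) (by linarith)]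
    have : 0 ≤ D * (u ^ 2) ^ 2 := by positivity
    nlinarith
  have h5 := mul_le_mul_of_nonneg_left h4 (sq_nonneg x)
  have : (x ^ 2 + u ^ 2) / D + (2 * x * u / D) ^ 2 / 2 = u ^ 2 / D + x ^ 2 * (1 / D + 2 * u ^ 2 / D ^ 2) := by
    field_simp; ring
  rw [this]
  have : x ^ 2 / (D - 2 * u ^ 2) = x ^ 2 * (1 / (D - 2 * u ^ 2)) := by ring
  rw [this]
  linarith

lemma exp_moment (n : ℕ) : ∀ (u : Fin n → ℝ) (x D : ℝ), 2 + 2 * ∑ i, u i ^ 2 ≤ D →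
    ∑ σ : Fin n → Bool, Real.exp ((x + ∑ i, u i * sgn (σ i)) ^ 2 / D) ≤
      2 ^ n * (Real.exp ((∑ i, u i ^ 2) / 2) * Real.exp (x ^ 2 / (D - 2 * ∑ i, u i ^ 2))) := by
  induction n with
  | zero => intro u x D h; simp
  | succ n ih =>
    intro u x D h
    rw [sum_peel]
    simp only [Fin.sum_univ_succ, Fin.cons_zero, Fin.cons_succ, sum_add_distrib] at h ⊢
    have hs : 2 + 2 * ∑ i : Fin n, u i.succ ^ 2 ≤ D := by nlinarith [sq_nonneg (u 0)]
    have h1 := ih (fun i => u i.succ) (x + u 0) D hs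
    have h2 := ih (fun i => u i.succ) (x - u 0) D hs
    have h3 := one_step x (u 0) (D - 2 * ∑ i : Fin n, u i.succ ^ 2) (by linarith)
    have h4 := mul_le_mul_of_nonneg_left h3 (show 0 ≤ 2 ^ n * Real.exp ((∑ i : Fin n, u i.succ ^ 2) / 2) by positivity)
    have e1 : ∀ y : ℝ, x + (u 0 * sgn true + y) = x + u 0 + y := by intro y; simp [sgn]; ring
    have e2 : ∀ y : ℝ, x + (u 0 * sgn false + y) = x - u 0 + y := by intro y; simp [sgn]; ring
    simp only [e1, e2]
    refine (add_le_add h1 h2).trans ?_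
    have e3 : D - 2 * (u 0 ^ 2 + ∑ i : Fin n, u i.succ ^ 2) = D - 2 * ∑ i : Fin n, u i.succ ^ 2 - 2 * u 0 ^ 2 := by ring
    rw [e3, add_div, Real.exp_add]
    calc _ = _ := by ring
      _ ≤ _ := h4
      _ = _ := by ring

lemma exp_quad (y : ℝ) : Real.exp y ≤ 1 + y + y ^ 2 * Real.exp |y| := by
  have h := Complex.norm_exp_sub_sum_le_norm_mul_exp (y : ℂ) 2
  have e : Complex.exp y - ∑ m ∈ range 2, (y : ℂ) ^ m / (m.factorial : ℂ) = ((Real.exp y - (1 + y) : ℝ) : ℂ) := by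
    simp [Finset.sum_range_succ]
  rw [e, Complex.norm_real, Complex.norm_real, Real.norm_eq_abs, Real.norm_eq_abs, sq_abs] at h
  linarith [le_abs_self (Real.exp y - (1 + y))]

lemma mgf_bound (n : ℕ) (u : Fin n → ℝ) (hu : ∑ i, u i ^ 2 = 1) (l : ℝ) (hl : |l| ≤ 1 / 8) :
    ∑ σ : Fin n → Bool, Real.exp (l * ((∑ i, u i * sgn (σ i)) ^ 2 - 1)) ≤
      2 ^ n * Real.exp (300 * l ^ 2) := by
  have hm := exp_moment n u 0 4 (by rw [hu]; norm_num)
  have h2 := second_moment n u 0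
  simp only [zero_add, hu] at hm h2
  norm_num at hm h2
  have hpt : ∀ X : ℝ, Real.exp (l * (X ^ 2 - 1)) ≤
      1 + l * (X ^ 2 - 1) + l ^ 2 * (128 * Real.exp (1 / 4) * Real.exp (X ^ 2 / 4)) := by
    intro X
    refine (exp_quad _).trans ?_
    have hY : |X ^ 2 - 1| ≤ X ^ 2 + 1 := by
      rw [abs_le]; constructor <;> nlinarith [sq_nonneg X]
    set Y := X ^ 2 - 1 with hYd
    have a1 : Y ^ 2 ≤ 128 * Real.exp (|Y| / 8) := by
      have := Real.quadratic_le_exp_of_nonneg (show 0 ≤ |Y| / 8 by positivity)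
      have h0 := abs_nonneg Y
      rw [← sq_abs Y]
      nlinarith
    have a2 : Real.exp |l * Y| ≤ Real.exp (|Y| / 8) := by
      apply Real.exp_le_exp.mpr
      rw [abs_mul]
      nlinarith [abs_nonneg Y]
    have a3 : Real.exp (|Y| / 8) * Real.exp (|Y| / 8) ≤ Real.exp (1 / 4) * Real.exp (X ^ 2 / 4) := by
      rw [← Real.exp_add, ← Real.exp_add]
      apply Real.exp_le_exp.mpr
      linarith
    have a4 : Y ^ 2 * Real.exp |l * Y| ≤ 128 * Real.exp (1 / 4) * Real.exp (X ^ 2 / 4) := by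
      calc _ ≤ (128 * Real.exp (|Y| / 8)) * Real.exp (|Y| / 8) := by gcongr
        _ = 128 * (Real.exp (|Y| / 8) * Real.exp (|Y| / 8)) := by ring
        _ ≤ 128 * (Real.exp (1 / 4) * Real.exp (X ^ 2 / 4)) := by gcongr
        _ = _ := by ring
    have := mul_le_mul_of_nonneg_left a4 (sq_nonneg l)
    rw [mul_pow]
    linarith
  refine (Finset.sum_le_sum (fun σ _ => hpt (∑ i, u i * sgn (σ i)))).trans ?_
  rw [sum_add_distrib, sum_add_distrib, ← mul_sum, ← mul_sum, ← mul_sum, sum_sub_distrib, h2]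
  simp only [sum_const, card_univ, Fintype.card_fun, Fintype.card_bool, Fintype.card_fin, nsmul_eq_mul]
  push_cast
  have hc : 128 * Real.exp (1 / 4) * Real.exp (1 / 2) ≤ 300 := by
    rw [mul_assoc, ← Real.exp_add]
    have h1 : Real.exp (1/4 + 1/2) ^ 4 ≤ (300 / 128) ^ 4 := by
      rw [← Real.exp_nat_mul]
      norm_num
      have := Real.exp_one_lt_d9
      have e3 : Real.exp 3 = Real.exp 1 ^ 3 := by rw [← Real.exp_nat_mul]; norm_num
      rw [e3]
      have : Real.exp 1 ^ 3 ≤ 2.7182818286 ^ 3 := by gcongr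
      refine this.trans (by norm_num)
    have := le_of_pow_le_pow_left₀ (by norm_num) (by norm_num) h1
    linarith
  have h5 : (300 * l ^ 2) + 1 ≤ Real.exp (300 * l ^ 2) := Real.add_one_le_exp _
  have h6 : l ^ 2 * (128 * Real.exp (1 / 4) * ∑ σ : Fin n → Bool, Real.exp ((∑ i, u i * sgn (σ i)) ^ 2 / 4)) ≤ l ^ 2 * (2 ^ n * 300) := by
    apply mul_le_mul_of_nonneg_left _ (sq_nonneg l)
    calc _ ≤ 128 * Real.exp (1 / 4) * (2 ^ n * Real.exp (1/2)) := by gcongr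
      _ = 2 ^ n * (128 * Real.exp (1 / 4) * Real.exp (1 / 2)) := by ring
      _ ≤ _ := by gcongr
  have h7 := mul_le_mul_of_nonneg_left h5 (show (0:ℝ) ≤ 2 ^ n by positivity)
  linarith
lemma topk {k : ℕ} (f v : Fin k → ℝ) (s : ℕ) (h0 : ∀ i, 0 ≤ f i) (h1 : ∀ i, f i ≤ 1)
    (hs : ∑ i, f i ≤ s) : ∃ S : Finset (Fin k), S.card ≤ s ∧ ∑ i, f i * v i ≤ ∑ i ∈ S, v i := by
  classical
  obtain ⟨S, hS, hmax⟩ := Finset.exists_max_image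
    ((Finset.univ : Finset (Finset (Fin k))).filter (fun S => S.card ≤ s)) (fun S => ∑ i ∈ S, v i)
    ⟨∅, by simp⟩
  simp only [mem_filter, mem_univ, true_and] at hS hmax
  refine ⟨S, hS, ?_⟩
  have hin : ∀ i ∈ S, 0 ≤ v i := by
    intro i hi
    have := hmax (S.erase i) ((card_erase_le).trans hS)
    rw [← Finset.add_sum_erase S v hi] at this
    linarith
  have key : ∃ t : ℝ, (∀ i ∈ S, t ≤ v i) ∧ (∀ i ∉ S, v i ≤ t) ∧ t * (∑ i, f i) ≤ t * S.card := by
    rcases lt_or_eq_of_le hS with hlt | heq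
    · refine ⟨0, hin, ?_, by simp⟩
      intro i hi
      have := hmax (insert i S) (by rw [card_insert_of_notMem hi]; omega)
      rw [sum_insert hi] at this
      linarith
    · rcases S.eq_empty_or_nonempty with he | hne
      · subst he
        simp at heq
        refine ⟨∑ i, |v i|, by simp, ?_, ?_⟩
        · intro i _
          exact (le_abs_self _).trans (Finset.single_le_sum (f := fun i => |v i|) (fun i _ => abs_nonneg _) (mem_univ i))
        · rw [← heq] at hs
          apply mul_le_mul_of_nonneg_left _ (Finset.sum_nonneg fun i _ => abs_nonneg _)
          simpa using hs
      · obtain ⟨j, hj, hjm⟩ := Finset.exists_min_image S v hne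
        refine ⟨v j, hjm, ?_, ?_⟩
        · intro i hi
          have hi' : i ∉ S.erase j := fun h => hi (mem_of_mem_erase h)
          have := hmax (insert i (S.erase j)) (by
            rw [card_insert_of_notMem hi', card_erase_of_mem hj]
            have := card_pos.mpr hne
            omega)
          rw [sum_insert hi', ← Finset.add_sum_erase S v hj] at this
          linarith
        · rw [heq]
          exact mul_le_mul_of_nonneg_left hs (hin j hj)
  obtain ⟨t, ht1, ht2, ht3⟩ := key
  have h : ∑ i, f i * (v i - t) ≤ ∑ i, (if i ∈ S then v i - t else 0) := by
    apply Finset.sum_le_sum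
    intro i _
    split_ifs with hi
    · nlinarith [ht1 i hi, h1 i]
    · nlinarith [ht2 i hi, h0 i]
  rw [← Finset.sum_filter] at h
  simp only [filter_univ_mem, mul_sub, sum_sub_distrib, sum_const, nsmul_eq_mul, ← Finset.sum_mul] at h
  nlinarith

lemma rounding {k : ℕ} (b v : Fin k → ℝ) (m : ℕ) (h1 : ∑ i, |b i| ≤ m) (h2 : ∑ i, b i ^ 2 ≤ m) :
    ∃ z : Fin k → ℤ, ∑ i, (z i) ^ 2 ≤ 4 * (m : ℤ) ∧ ∑ i, b i * v i ≤ ∑ i, (z i : ℝ) * v i := by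
  classical
  set n : Fin k → ℕ := fun i => ⌊|b i|⌋₊ with hn
  set e : Fin k → ℤ := fun i => if 0 ≤ b i then 1 else -1 with he
  have hfl : ∀ i, (n i : ℝ) ≤ |b i| := fun i => Nat.floor_le (abs_nonneg _)
  have hfu : ∀ i, |b i| ≤ n i + 1 := fun i => (Nat.lt_floor_add_one _).le
  obtain ⟨S, hS, hle⟩ := topk (fun i => |b i| - n i) (fun i => (e i : ℝ) * v i) m
    (fun i => by linarith [hfl i]) (fun i => by linarith [hfu i]) (by
      refine le_trans (Finset.sum_le_sum fun i _ => ?_) h1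
      have : (0 : ℝ) ≤ n i := by positivity
      linarith)
  have he2 : ∀ i, e i ^ 2 = 1 := by intro i; simp only [he]; split_ifs <;> norm_num
  have heb : ∀ i, |b i| * e i = b i := by
    intro i; simp only [he]; split_ifs with h
    · simp [abs_of_nonneg h]
    · simp [abs_of_neg (not_le.mp h)]
  refine ⟨fun i => e i * (n i + if i ∈ S then 1 else 0), ?_, ?_⟩
  · have : ((∑ i, (e i * ((n i : ℤ) + if i ∈ S then 1 else 0)) ^ 2 : ℤ) : ℝ) ≤ ((4 * (m : ℤ) : ℤ) : ℝ) := by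
      push_cast
      have hp : ∀ i, ((e i : ℝ) * ((n i : ℝ) + if i ∈ S then 1 else 0)) ^ 2 ≤
          2 * b i ^ 2 + 2 * (if i ∈ S then 1 else 0) := by
        intro i
        have h3 : (e i : ℝ) ^ 2 = 1 := by exact_mod_cast he2 i
        have h4 : (n i : ℝ) ^ 2 ≤ b i ^ 2 := by
          rw [← sq_abs (b i)]
          exact pow_le_pow_left₀ (by positivity) (hfl i) 2
        rw [mul_pow, h3]
        split_ifs <;> nlinarith [sq_nonneg ((n i : ℝ) - 1)]
      refine (Finset.sum_le_sum fun i _ => hp i).trans ?_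
      rw [sum_add_distrib, ← mul_sum, ← mul_sum, Finset.sum_boole]
      simp only [filter_univ_mem]
      have : (S.card : ℝ) ≤ m := by exact_mod_cast hS
      linarith
    exact_mod_cast this
  · have e1 : ∑ i, b i * v i = ∑ i, (|b i| - n i) * (e i * v i) + ∑ i, n i * (e i * v i) := by
      rw [← sum_add_distrib]
      refine Finset.sum_congr rfl fun i _ => ?_
      rw [← add_mul, sub_add_cancel, ← mul_assoc, heb]
    have e2 : ∑ i, ((e i * ((n i : ℤ) + if i ∈ S then 1 else 0) : ℤ) : ℝ) * v i =
        ∑ i ∈ S, e i * v i + ∑ i, n i * (e i * v i) := by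
      rw [← Finset.sum_filter_add_sum_filter_not univ (fun i => i ∈ S) (fun i => ((e i * ((n i : ℤ) + if i ∈ S then 1 else 0) : ℤ) : ℝ) * v i)]
      have : ∑ i ∈ S, (e i : ℝ) * v i = ∑ i, if i ∈ S then (e i : ℝ) * v i else 0 := by
        rw [← Finset.sum_filter]; simp
      rw [this, ← sum_add_distrib, Finset.sum_filter_add_sum_filter_not]
      refine Finset.sum_congr rfl fun i _ => ?_
      push_cast
      split_ifs <;> ring
    rw [e1, e2]
    linarith

/-- bilinear form -/
noncomputable def bil {k : ℕ} (M : Fin k → Fin k → ℝ) (x y : Fin k → ℝ) : ℝ :=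
  ∑ i, x i * ∑ j, M i j * y j

lemma bil_comm {k : ℕ} (M : Fin k → Fin k → ℝ) (hM : ∀ i j, M i j = M j i) (x y : Fin k → ℝ) :
    bil M x y = bil M y x := by
  unfold bil
  simp only [Finset.mul_sum]
  rw [Finset.sum_comm]
  refine Finset.sum_congr rfl fun i _ => Finset.sum_congr rfl fun j _ => ?_
  rw [hM]; ring

lemma bil_polar {k : ℕ} (M : Fin k → Fin k → ℝ) (hM : ∀ i j, M i j = M j i) (x y : Fin k → ℝ) :
    4 * bil M x y = bil M (fun i => x i + y i) (fun i => x i + y i)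
      - bil M (fun i => x i - y i) (fun i => x i - y i) := by
  have h := bil_comm M hM x y
  have : bil M (fun i => x i + y i) (fun i => x i + y i)
      - bil M (fun i => x i - y i) (fun i => x i - y i) = 2 * bil M x y + 2 * bil M y x := by
    unfold bil
    rw [← Finset.sum_sub_distrib, Finset.mul_sum, Finset.mul_sum, ← Finset.sum_add_distrib]
    refine Finset.sum_congr rfl fun i _ => ?_
    simp only [mul_add, mul_sub, sum_add_distrib, sum_sub_distrib]
    ring
  rw [this, ← h]; ring

lemma determ {k : ℕ} (M : Fin k → Fin k → ℝ) (hM : ∀ i j, M i j = M j i) (m : ℕ)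
    (hQ : ∀ w : Fin k → ℤ, ∑ i, (w i) ^ 2 ≤ 16 * (m : ℤ) →
      |bil M (fun i => (w i : ℝ)) (fun i => (w i : ℝ))| ≤ 3 / 2 * m)
    (b : Fin k → ℝ) (h1 : ∑ i, |b i| ≤ m) (h2 : ∑ i, b i ^ 2 ≤ m) :
    bil M b b ≤ 3 / 4 * m := by
  obtain ⟨z, hz, hzl⟩ := rounding b (fun i => ∑ j, M i j * b j) m h1 h2
  obtain ⟨y, hy, hyl⟩ := rounding b (fun i => ∑ j, M i j * (z j : ℝ)) m h1 h2
  change bil M b b ≤ bil M (fun i => (z i : ℝ)) b at hzl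
  change bil M b (fun i => (z i : ℝ)) ≤ bil M (fun i => (y i : ℝ)) (fun i => (z i : ℝ)) at hyl
  rw [bil_comm M hM] at hyl
  have hp := bil_polar M hM (fun i => (y i : ℝ)) (fun i => (z i : ℝ))
  have hs : ∑ i, (y i + z i) ^ 2 + ∑ i, (y i - z i) ^ 2 = 2 * ∑ i, y i ^ 2 + 2 * ∑ i, z i ^ 2 := by
    rw [mul_sum, mul_sum, ← sum_add_distrib, ← sum_add_distrib]
    exact Finset.sum_congr rfl fun i _ => by ring
  have n1 : 0 ≤ ∑ i, (y i + z i) ^ 2 := Finset.sum_nonneg fun i _ => sq_nonneg _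
  have n2 : 0 ≤ ∑ i, (y i - z i) ^ 2 := Finset.sum_nonneg fun i _ => sq_nonneg _
  have q1 := hQ (fun i => y i + z i) (by linarith)
  have q2 := hQ (fun i => y i - z i) (by linarith)
  push_cast at q1 q2
  rw [abs_le] at q1 q2
  linarith

lemma geo (q : ℝ) (h0 : 0 ≤ q) (h1 : q ≤ 1 / 2) (L : ℕ) :
    ∑ t ∈ Finset.Icc (-(L : ℤ)) L, q ^ t.natAbs ≤ 1 + 4 * q - 4 * q ^ (L + 1) := by
  induction L with
  | zero => simp
  | succ L ih =>
    have : Finset.Icc (-((L + 1 : ℕ) : ℤ)) ((L + 1 : ℕ) : ℤ) =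
        insert (-((L + 1 : ℕ) : ℤ)) (insert ((L + 1 : ℕ) : ℤ) (Finset.Icc (-(L : ℤ)) L)) := by
      ext t; simp only [Finset.mem_insert, Finset.mem_Icc]; omega
    rw [this, sum_insert (by simp only [Finset.mem_insert, Finset.mem_Icc]; omega),
      sum_insert (by simp only [Finset.mem_Icc]; omega), Int.natAbs_neg, Int.natAbs_natCast]
    have : 0 ≤ q ^ (L + 1) := by positivity
    rw [pow_succ q (L + 1)]
    nlinarith

/-- net -/
noncomputable def net (k m : ℕ) : Finset (Fin k → ℤ) :=
  (Fintype.piFinset (fun _ : Fin k => Finset.Icc (-((16 * m : ℕ) : ℤ)) ((16 * m : ℕ) : ℤ))).filter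
    (fun w => ∑ i, (w i) ^ 2 ≤ 16 * (m : ℤ))

lemma mem_net (k m : ℕ) (w : Fin k → ℤ) (hw : ∑ i, (w i) ^ 2 ≤ 16 * (m : ℤ)) : w ∈ net k m := by
  unfold net
  rw [mem_filter, Fintype.mem_piFinset]
  refine ⟨fun i => ?_, hw⟩
  have h1 : (w i) ^ 2 ≤ 16 * (m : ℤ) :=
    (Finset.single_le_sum (f := fun i => (w i) ^ 2) (fun i _ => sq_nonneg _) (mem_univ i)).trans hw
  have h2 : |w i| ≤ w i ^ 2 := by
    rw [← sq_abs]; rcases eq_or_lt_of_le (abs_nonneg (w i)) with h | h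
    · rw [← h]; simp
    · nlinarith
  have h3 := abs_le.mp (h2.trans h1)
  rw [Finset.mem_Icc]; push_cast; exact h3

lemma net_card (k m : ℕ) (q : ℝ) (h0 : 0 < q) (h1 : q ≤ 1 / 2) :
    ((net k m).card : ℝ) * q ^ (16 * m) ≤ Real.exp (4 * q * k) := by
  have h2 : ((net k m).card : ℝ) * q ^ (16 * m) ≤ ∑ w ∈ net k m, ∏ i, q ^ (w i).natAbs := by
    rw [← nsmul_eq_mul]
    apply Finset.card_nsmul_le_sum
    intro w hw
    rw [Finset.prod_pow_eq_pow_sum]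
    apply pow_le_pow_of_le_one h0.le (by linarith)
    have hw2 := (mem_filter.mp hw).2
    have : ((∑ i, (w i).natAbs : ℕ) : ℤ) ≤ ∑ i, (w i) ^ 2 := by
      push_cast
      refine Finset.sum_le_sum fun i _ => ?_
      rw [← sq_abs]; rcases eq_or_lt_of_le (abs_nonneg (w i)) with h | h
      · rw [← h]; simp
      · nlinarith
    have := this.trans hw2
    exact_mod_cast this
  refine h2.trans ?_
  refine (Finset.sum_le_sum_of_subset_of_nonneg (Finset.filter_subset _ _)
    (fun w _ _ => Finset.prod_nonneg fun i _ => by positivity)).trans ?_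
  rw [Finset.sum_prod_piFinset _ (fun (_ : Fin k) (t : ℤ) => q ^ t.natAbs)]
  rw [Finset.prod_const, card_univ, Fintype.card_fin]
  have h3 := geo q h0.le h1 (16 * m)
  have h4 : ∑ t ∈ Finset.Icc (-((16 * m : ℕ) : ℤ)) ((16 * m : ℕ) : ℤ), q ^ t.natAbs ≤ Real.exp (4 * q) := by
    have := Real.add_one_le_exp (4 * q)
    have : 0 ≤ q ^ (16 * m + 1) := by positivity
    linarith
  refine (pow_le_pow_left₀ (Finset.sum_nonneg fun i _ => by positivity) h4 k).trans ?_
  rw [← Real.exp_nat_mul]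
  apply le_of_eq; ring_nf

lemma array_mgf (k : ℕ) (u : Fin k → ℝ) (hu : ∑ i, u i ^ 2 = 1) (l : ℝ) (hl : |l| ≤ 1 / 8) :
    ∑ ε : Fin k → Fin k → Bool, Real.exp (l * (∑ j, (∑ i, u i * sgn (ε i j)) ^ 2 - k)) ≤
      2 ^ (k * k) * Real.exp (300 * l ^ 2 * k) := by
  rw [← (Equiv.piComm (fun (_ _ : Fin k) => Bool)).sum_comp]
  have h1 : ∀ ε : Fin k → Fin k → Bool,
      Real.exp (l * (∑ j, (∑ i, u i * sgn ((Equiv.piComm (fun (_ _ : Fin k) => Bool)) ε i j)) ^ 2 - k))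
      = ∏ j, Real.exp (l * ((∑ i, u i * sgn (ε j i)) ^ 2 - 1)) := by
    intro ε
    rw [← Real.exp_sum, ← Finset.mul_sum, Finset.sum_sub_distrib]
    simp [Equiv.piComm]
  simp only [h1]
  have h2 := Finset.sum_prod_piFinset (ι := Fin k) (univ : Finset (Fin k → Bool))
    (fun _ σ => Real.exp (l * ((∑ i, u i * sgn (σ i)) ^ 2 - 1)))
  rw [Fintype.piFinset_univ] at h2
  rw [h2, Finset.prod_const, card_univ, Fintype.card_fin]
  refine (pow_le_pow_left₀ (Finset.sum_nonneg fun i _ => by positivity) (mgf_bound k u hu l hl) k).trans ?_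
  rw [mul_pow, ← pow_mul, ← Real.exp_nat_mul]
  apply le_of_eq; ring_nf

lemma tail (k : ℕ) (u : Fin k → ℝ) (hu : ∑ i, u i ^ 2 = 1) (l : ℝ) (hl : |l| = 1 / 6400) :
    (((Finset.univ : Finset (Fin k → Fin k → Bool)).filter (fun ε =>
      1 / 6400 * (3 / 32 * k) ≤ l * (∑ j, (∑ i, u i * sgn (ε i j)) ^ 2 - k))).card : ℝ) ≤
      2 ^ (k * k) * Real.exp (-(3 / 409600 * k)) := by
  have h := array_mgf k u hu l (by rw [hl]; norm_num)
  have hl2 : l ^ 2 = (1 / 6400) ^ 2 := by rw [← sq_abs, hl]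
  rw [hl2] at h
  have h2 : (((Finset.univ : Finset (Fin k → Fin k → Bool)).filter (fun ε =>
      1 / 6400 * (3 / 32 * k) ≤ l * (∑ j, (∑ i, u i * sgn (ε i j)) ^ 2 - k))).card : ℝ) *
      Real.exp (1 / 6400 * (3 / 32 * k)) ≤ ∑ ε : Fin k → Fin k → Bool,
        Real.exp (l * (∑ j, (∑ i, u i * sgn (ε i j)) ^ 2 - k)) := by
    rw [← nsmul_eq_mul]
    refine (Finset.card_nsmul_le_sum _ (fun ε : Fin k → Fin k → Bool =>
      Real.exp (l * (∑ j, (∑ i, u i * sgn (ε i j)) ^ 2 - k))) _ ?_).trans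
      (Finset.sum_le_sum_of_subset_of_nonneg (Finset.filter_subset _ _) (fun _ _ _ => by positivity))
    intro ε hε
    exact Real.exp_le_exp.mpr (mem_filter.mp hε).2
  have h3 := h2.trans h
  rw [← le_div_iff₀ (Real.exp_pos _), mul_div_assoc, ← Real.exp_sub] at h3
  refine h3.trans (le_of_eq ?_)
  congr 2
  ring

lemma tail_two (k : ℕ) (w : Fin k → ℝ) :
    (((Finset.univ : Finset (Fin k → Fin k → Bool)).filter (fun ε =>
      3 / 32 * k * (∑ i, w i ^ 2) < |∑ j, (∑ i, w i * sgn (ε i j)) ^ 2 - k * ∑ i, w i ^ 2|)).card : ℝ) ≤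
      2 * (2 ^ (k * k) * Real.exp (-(3 / 409600 * k))) := by
  classical
  set R := ∑ i, w i ^ 2 with hR
  have hR0 : 0 ≤ R := Finset.sum_nonneg fun i _ => sq_nonneg _
  rcases eq_or_lt_of_le hR0 with h0 | hpos
  · have hw : ∀ i, w i = 0 := by
      intro i
      have := (Finset.sum_eq_zero_iff_of_nonneg (fun i _ => sq_nonneg (w i))).mp (hR.symm.trans h0.symm) i (mem_univ i)
      simpa using this
    simp only [hw, ← h0]
    simp
    positivity
  · set u : Fin k → ℝ := fun i => w i / √R with hu
    have hsq : √R ^ 2 = R := Real.sq_sqrt hR0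
    have hu1 : ∑ i, u i ^ 2 = 1 := by
      simp only [hu, div_pow, hsq, ← Finset.sum_div]
      exact div_self hpos.ne'
    have hux : ∀ ε : Fin k → Fin k → Bool, ∑ j, (∑ i, w i * sgn (ε i j)) ^ 2 =
        R * ∑ j, (∑ i, u i * sgn (ε i j)) ^ 2 := by
      intro ε
      rw [Finset.mul_sum]
      refine Finset.sum_congr rfl fun j _ => ?_
      have : ∑ i, w i * sgn (ε i j) = √R * ∑ i, u i * sgn (ε i j) := by
        rw [Finset.mul_sum]
        refine Finset.sum_congr rfl fun i _ => ?_
        have : √R ≠ 0 := (Real.sqrt_pos.mpr hpos).ne'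
        simp only [hu]; field_simp
      rw [this, mul_pow, hsq]
    have t1 := tail k u hu1 (1 / 6400) (by norm_num)
    have t2 := tail k u hu1 (-(1 / 6400)) (by norm_num)
    have hsub : ((Finset.univ : Finset (Fin k → Fin k → Bool)).filter (fun ε =>
      3 / 32 * k * R < |∑ j, (∑ i, w i * sgn (ε i j)) ^ 2 - k * R|)) ⊆
      ((Finset.univ : Finset (Fin k → Fin k → Bool)).filter (fun ε =>
      1 / 6400 * (3 / 32 * (k : ℝ)) ≤ 1 / 6400 * (∑ j, (∑ i, u i * sgn (ε i j)) ^ 2 - k))) ∪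
      ((Finset.univ : Finset (Fin k → Fin k → Bool)).filter (fun ε =>
      1 / 6400 * (3 / 32 * (k : ℝ)) ≤ -(1 / 6400) * (∑ j, (∑ i, u i * sgn (ε i j)) ^ 2 - k))) := by
      intro ε hε
      simp only [mem_filter, mem_univ, true_and, mem_union] at hε ⊢
      rw [hux] at hε
      set T := ∑ j, (∑ i, u i * sgn (ε i j)) ^ 2
      have : R * T - k * R = R * (T - k) := by ring
      rw [this, abs_mul, abs_of_pos hpos, mul_comm _ R] at hε
      have h := lt_of_mul_lt_mul_left hε hR0
      rcases lt_abs.mp h with h | h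
      · left; linarith
      · right; linarith
    have hc := (Finset.card_le_card hsub).trans (Finset.card_union_le _ _)
    have hc' : (_ : ℝ) ≤ _ := Nat.cast_le.mpr hc
    rw [Nat.cast_add] at hc'
    linarith
lemma Agk_large {k : ℕ} (hk : 0 < k) {γ : ℝ} (hγ : 0 < γ) {a : Fin k → ℝ} (ha : a ∈ Agk k γ) :
    ∑ i, |a i| ≤ γ * √k ∧ 1 ≤ γ ^ 2 * k := by
  obtain ⟨h1, h2⟩ := ha
  have hs : 0 < √(k : ℝ) := Real.sqrt_pos.mpr (by exact_mod_cast hk)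
  rw [inv_mul_le_iff₀ hs, mul_comm] at h2
  refine ⟨h2, ?_⟩
  have h3 : (1 : ℝ) ≤ ∑ i, |a i| := by
    rw [← h1]
    refine Finset.sum_le_sum fun i _ => ?_
    have : a i ^ 2 ≤ 1 := by
      rw [← h1]
      exact Finset.single_le_sum (f := fun i => a i ^ 2) (fun i _ => sq_nonneg _) (mem_univ i)
    have h4 : |a i| ≤ 1 := by rwa [← sq_le_one_iff_abs_le_one]
    rw [← sq_abs]
    nlinarith [abs_nonneg (a i)]
  have h5 := h3.trans h2
  have h6 : √(k : ℝ) ^ 2 = k := Real.sq_sqrt (by positivity)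
  have : (γ * √k) ^ 2 = γ ^ 2 * k := by rw [mul_pow, h6]
  nlinarith

lemma bil_gram {k : ℕ} (ε : Fin k → Fin k → Bool) (x : Fin k → ℝ) :
    bil (fun i i' => (k : ℝ)⁻¹ * ∑ j, sgn (ε i j) * sgn (ε i' j) - if i = i' then 1 else 0) x x =
      (k : ℝ)⁻¹ * ∑ j, (∑ i, x i * sgn (ε i j)) ^ 2 - ∑ i, x i ^ 2 := by
  have e1 : ∑ j, (∑ i, x i * sgn (ε i j)) ^ 2 =
      ∑ i, x i * ∑ i', (∑ j, sgn (ε i j) * sgn (ε i' j)) * x i' := by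
    have : ∀ j, (∑ i, x i * sgn (ε i j)) ^ 2 = ∑ i, ∑ i', x i * (sgn (ε i j) * sgn (ε i' j) * x i') := by
      intro j
      rw [sq, Finset.sum_mul_sum]
      exact Finset.sum_congr rfl fun i _ => Finset.sum_congr rfl fun i' _ => by ring
    simp only [this]
    rw [Finset.sum_comm]
    refine Finset.sum_congr rfl fun i _ => ?_
    rw [Finset.sum_comm, Finset.mul_sum]
    refine Finset.sum_congr rfl fun i' _ => ?_
    rw [← Finset.mul_sum, Finset.sum_mul]
  rw [e1, Finset.mul_sum, ← Finset.sum_sub_distrib]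
  unfold bil
  refine Finset.sum_congr rfl fun i _ => ?_
  simp only [sub_mul, sum_sub_distrib, ite_mul, one_mul, zero_mul, Finset.sum_ite_eq, mem_univ, if_true]
  simp only [mul_assoc, ← Finset.mul_sum]
  ring

lemma bil_neg {k : ℕ} (M : Fin k → Fin k → ℝ) (x y : Fin k → ℝ) :
    bil (fun i j => - M i j) x y = - bil M x y := by
  simp [bil, Finset.sum_neg_distrib]

lemma bad_net {k : ℕ} (hk : 0 < k) {γ : ℝ} (hγ : 0 < γ) (m : ℕ) (hm : γ ^ 2 * k ≤ m)
    (ε : Fin k → Fin k → Bool) {a : Fin k → ℝ} (ha : a ∈ Agk k γ)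
    (hbad : |Real.sqrt ((k : ℝ)⁻¹ * ∑ j, (∑ i, a i * sgn (ε i j)) ^ 2) - 1| > 1 / 2) :
    ∃ w ∈ net k m, 3 / 32 * k * (∑ i, (w i : ℝ) ^ 2) <
      |∑ j, (∑ i, (w i : ℝ) * sgn (ε i j)) ^ 2 - k * ∑ i, (w i : ℝ) ^ 2| := by
  by_contra! hcon
  have hk' : (0 : ℝ) < k := by exact_mod_cast hk
  obtain ⟨hl1, hl2⟩ := Agk_large hk hγ ha
  have ha2 := ha.1
  set M : Fin k → Fin k → ℝ :=
    fun i i' => (k : ℝ)⁻¹ * ∑ j, sgn (ε i j) * sgn (ε i' j) - if i = i' then 1 else 0 with hM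
  have hsym : ∀ i j, M i j = M j i := by
    intro i j
    simp only [hM, mul_comm, eq_comm]
  have hQ : ∀ w : Fin k → ℤ, ∑ i, (w i) ^ 2 ≤ 16 * (m : ℤ) →
      |bil M (fun i => (w i : ℝ)) (fun i => (w i : ℝ))| ≤ 3 / 2 * m := by
    intro w hw
    have h := hcon w (mem_net k m w hw)
    rw [bil_gram]
    have hw' : ∑ i, (w i : ℝ) ^ 2 ≤ 16 * m := by exact_mod_cast hw
    set T := ∑ j, (∑ i, (w i : ℝ) * sgn (ε i j)) ^ 2
    set R := ∑ i, (w i : ℝ) ^ 2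
    have e : (k : ℝ)⁻¹ * T - R = (k : ℝ)⁻¹ * (T - k * R) := by field_simp
    rw [e, abs_mul, abs_of_pos (inv_pos.mpr hk'), inv_mul_le_iff₀ hk']
    refine h.trans ?_
    nlinarith
  have hm1 : (1 : ℝ) ≤ m := hl2.trans hm
  have hm0 : (0 : ℝ) ≤ m := by linarith
  have hmm : √(m : ℝ) * √(m : ℝ) = m := Real.mul_self_sqrt hm0
  set b : Fin k → ℝ := fun i => √(m : ℝ) * a i with hb
  have hb1 : ∑ i, |b i| ≤ m := by
    simp only [hb, abs_mul, abs_of_nonneg (Real.sqrt_nonneg _), ← Finset.mul_sum]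
    have : γ * √k ≤ √(m : ℝ) := by
      apply Real.le_sqrt_of_sq_le
      rw [mul_pow, Real.sq_sqrt hk'.le]; exact hm
    calc _ ≤ √(m : ℝ) * √(m : ℝ) := mul_le_mul_of_nonneg_left (hl1.trans this) (Real.sqrt_nonneg _)
      _ = _ := hmm
  have hb2 : ∑ i, b i ^ 2 ≤ m := by
    simp only [hb, mul_pow, ← Finset.mul_sum, ha2]
    rw [sq, hmm, mul_one]
  have hbb : bil M b b = m * bil M a a := by
    simp only [bil, hb, Finset.mul_sum]
    refine Finset.sum_congr rfl fun i _ => Finset.sum_congr rfl fun j _ => ?_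
    linear_combination (a i * M i j * a j) * hmm
  have d1 := determ M hsym m hQ b hb1 hb2
  have d2 := determ (fun i j => - M i j) (fun i j => by rw [hsym]) m
    (fun w hw => by rw [bil_neg, abs_neg]; exact hQ w hw) b hb1 hb2
  rw [bil_neg] at d2
  rw [hbb] at d1 d2
  have f1 : bil M a a ≤ 3 / 4 := by nlinarith
  have f2 : -(3 / 4) ≤ bil M a a := by nlinarith
  rw [bil_gram, ha2] at f1 f2
  set V := (k : ℝ)⁻¹ * ∑ j, (∑ i, a i * sgn (ε i j)) ^ 2
  have g1 : √V ≤ 3 / 2 := by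
    rw [Real.sqrt_le_left (by norm_num)]; linarith
  have g2 : 1 / 2 ≤ √V := by
    apply Real.le_sqrt_of_sq_le; linarith
  have : |√V - 1| ≤ 1 / 2 := by rw [abs_le]; constructor <;> linarith
  linarith

/-- There are absolute constants `0 < γ < 1` and `η > 0` such that for every positive
integer `k`,
`P(∃ a ∈ A_γ^k, |(k⁻¹ ∑_j (∑_i a_i ε_{i,j})²)^{1/2} − 1| > 1/2) ≤ e^{−η k}`. -/
theorem stmt9 :
    ∃ γ η : ℝ, 0 < γ ∧ γ < 1 ∧ 0 < η ∧ ∀ k : ℕ, 0 < k →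
      signProb k (fun ε => ∃ a ∈ Agk k γ,
          |Real.sqrt ((k : ℝ)⁻¹ * ∑ j, (∑ i, a i * sgn (ε i j)) ^ 2) - 1| > 1 / 2)
        ≤ Real.exp (-(η * k)) := by
  classical
  obtain ⟨c, hc⟩ : ∃ c : ℝ, c = 3 / 409600 := ⟨_, rfl⟩
  have hc0 : 0 < c := by rw [hc]; norm_num
  have hc1 : c < 1 := by rw [hc]; norm_num
  refine ⟨c / 64, c / 4, by positivity, by linarith, by positivity, fun k hk => ?_⟩
  have hk' : (0 : ℝ) < k := by exact_mod_cast hk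
  have hγ : 0 < c / 64 := by positivity
  unfold signProb
  by_cases hlarge : 1 ≤ (c / 64) ^ 2 * k
  · obtain ⟨m, hmd⟩ : ∃ m : ℕ, m = ⌈(c / 64) ^ 2 * (k : ℝ)⌉₊ := ⟨_, rfl⟩
    have hm1 : (c / 64) ^ 2 * k ≤ m := by rw [hmd]; exact Nat.le_ceil _
    have hm2 : (m : ℝ) ≤ 2 * ((c / 64) ^ 2 * k) := by
      have := Nat.ceil_lt_add_one (show 0 ≤ (c / 64) ^ 2 * (k : ℝ) by positivity)
      rw [← hmd] at this
      linarith
    rw [div_le_iff₀ (by positivity)]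
    have hN := net_card k m (c / 16) (by positivity) (by linarith)
    have hq : Real.exp (-(c / 4 * k)) ≤ (c / 16) ^ (16 * m) := by
      have h1 : Real.exp (-(16 / c)) ≤ c / 16 := by
        rw [Real.exp_neg, inv_le_comm₀ (Real.exp_pos _) (by positivity), inv_div]
        linarith [Real.add_one_le_exp (16 / c)]
      refine le_trans ?_ (pow_le_pow_left₀ (Real.exp_pos _).le h1 (16 * m))
      rw [← Real.exp_nat_mul]
      apply Real.exp_le_exp.mpr
      push_cast
      have : 16 * (m : ℝ) * -(16 / c) = -(256 / c * m) := by ring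
      rw [this]
      have h2 : 256 / c * m ≤ 256 / c * (2 * ((c / 64) ^ 2 * k)) := by gcongr
      have h3 : 256 / c * (2 * ((c / 64) ^ 2 * k)) = c / 8 * k := by field_simp; norm_num
      have : 0 < c * k := by positivity
      linarith
    have hN2 : ((net k m).card : ℝ) ≤ Real.exp (c / 2 * k) := by
      have h1 : ((net k m).card : ℝ) * Real.exp (-(c / 4 * k)) ≤ Real.exp (4 * (c / 16) * k) :=
        (mul_le_mul_of_nonneg_left hq (by positivity)).trans hN
      rw [← le_div_iff₀ (Real.exp_pos _), ← Real.exp_sub] at h1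
      refine h1.trans (le_of_eq ?_)
      congr 1; ring
    have h2e : (2 : ℝ) ≤ Real.exp (c / 4 * k) := by
      have h1 : 1 ≤ c / 4 * k := by
        refine hlarge.trans ?_
        apply mul_le_mul_of_nonneg_right _ hk'.le
        nlinarith
      linarith [Real.add_one_le_exp (c / 4 * k)]
    have hsub : (Finset.univ.filter (fun ε : Fin k → Fin k → Bool => ∃ a ∈ Agk k (c / 64),
          |Real.sqrt ((k : ℝ)⁻¹ * ∑ j, (∑ i, a i * sgn (ε i j)) ^ 2) - 1| > 1 / 2)) ⊆
        (net k m).biUnion (fun w => Finset.univ.filter (fun ε : Fin k → Fin k → Bool =>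
          3 / 32 * k * (∑ i, (w i : ℝ) ^ 2) <
      |∑ j, (∑ i, (w i : ℝ) * sgn (ε i j)) ^ 2 - k * ∑ i, (w i : ℝ) ^ 2|)) := by
      intro ε hε
      obtain ⟨a, ha, hbad⟩ := (mem_filter.mp hε).2
      obtain ⟨w, hw, hlt⟩ := bad_net hk hγ m hm1 ε ha hbad
      exact mem_biUnion.mpr ⟨w, hw, mem_filter.mpr ⟨mem_univ _, hlt⟩⟩
    have hcard := (Finset.card_le_card hsub).trans Finset.card_biUnion_le
    have hcard' : (_ : ℝ) ≤ _ := Nat.cast_le.mpr hcard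
    rw [Nat.cast_sum] at hcard'
    have hcard2 := hcard'.trans (c := (net k m).card • (2 * (2 ^ (k * k) * Real.exp (-(c * k))))) (by
      apply Finset.sum_le_card_nsmul
      intro w _
      have := tail_two k (fun i => (w i : ℝ))
      rw [hc]
      convert this using 2)
    refine le_trans (le_of_eq ?_) (hcard2.trans ?_)
    · congr!
    rw [nsmul_eq_mul]
    calc _ ≤ Real.exp (c / 2 * k) * (Real.exp (c / 4 * k) * (2 ^ (k * k) * Real.exp (-(c * k)))) := by
          gcongr
      _ = (Real.exp (c / 2 * k) * Real.exp (c / 4 * k) * Real.exp (-(c * k))) * 2 ^ (k * k) := by ring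
      _ = _ := by
          rw [← Real.exp_add, ← Real.exp_add]
          congr 2; ring
  · rw [Finset.filter_false_of_mem]
    · simp; positivity
    · rintro ε _ ⟨a, ha, _⟩
      exact hlarge (Agk_large hk hγ ha).2
end
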